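/- arXiv:2101.00070 — 8 statements merged into one kernel-verified Lean document; each statement's English description precedes it below -/
import Mathlib

section
/- Suppose a = 0, E ≠ b and E² ≠ b² + 1. Then the only ℓ²-solution of the half-line eigenvalue equation at energy E is the zero sequence. -/
open Matrix

noncomputable section

/-- The hopping matrix `A` with rows `(0,1)` and `(0,0)`. -/
def Amat : Matrix (Fin 2) (Fin 2) ℂ := !![0, 1; 0, 0]

/-- The on-site matrix `V` with rows `(b,a)` and `(a,-b)`. -/
def Vmat (a b : ℝ) : Matrix (Fin 2) (Fin 2) ℂ := !![(b : ℂ), (a : ℂ); (a : ℂ), -(b : ℂ)]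

/-- `ψ : ℕ → ℂ²`, where `ψ 0` represents `ψ(1)`, is a solution of the half-line
eigenvalue equation at energy `E`:
`(V - E)ψ(1) + A*ψ(2) = 0` and `Aψ(n) + (V - E)ψ(n+1) + A*ψ(n+2) = 0` for `n ≥ 1`. -/
def IsSol (a b E : ℝ) (ψ : ℕ → EuclideanSpace ℂ (Fin 2)) : Prop :=
  (Vmat a b - (E : ℂ) • 1).mulVec (ψ 0) + (Amat)ᴴ.mulVec (ψ 1) = 0 ∧
  ∀ n : ℕ, Amat.mulVec (ψ n) + (Vmat a b - (E : ℂ) • 1).mulVec (ψ (n + 1))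
      + (Amat)ᴴ.mulVec (ψ (n + 2)) = 0

/-- The ℓ² condition `∑ ‖ψ(n)‖² < ∞`. -/
def IsL2 (ψ : ℕ → EuclideanSpace ℂ (Fin 2)) : Prop :=
  Summable fun n => ‖ψ n‖ ^ 2

end

/-- If `a = 0`, `E ≠ b` and `E² ≠ b² + 1`, the only ℓ²-solution is the zero sequence. -/
theorem no_nonzero_L2_solution (a b E : ℝ) (ha : a = 0) (hEb : E ≠ b)
    (hE : E ^ 2 ≠ b ^ 2 + 1) :
    ∀ ψ : ℕ → EuclideanSpace ℂ (Fin 2), IsSol a b E ψ → IsL2 ψ → ψ = 0 := by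
  intro ψ hsol _
  obtain ⟨h0, h⟩ := hsol
  subst ha
  have hb : (b : ℂ) - E ≠ 0 := by
    intro h'
    apply hEb
    have h2 : (b : ℂ) = E := sub_eq_zero.mp h'
    exact_mod_cast h2.symm
  have hc : (1 : ℂ) + (b - E) * (b + E) ≠ 0 := by
    intro h'
    apply hE
    have h2 : (1 : ℝ) + (b - E) * (b + E) = 0 := by exact_mod_cast h'
    linarith
  have e0 := congrFun h0 0
  have e1 := congrFun h0 1
  have f0 := fun n => congrFun (h n) 0
  have f1 := fun n => congrFun (h n) 1
  simp [Amat, Vmat, Matrix.mulVec, dotProduct, Fin.sum_univ_two, Matrix.one_apply] at e0 e1 f0 f1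
  have hu0 : ψ 0 0 = 0 := by
    rcases e0 with e0 | e0
    · exact absurd e0 hb
    · exact e0
  have hu : ∀ n, ψ (n + 1) 0 = (b + E) * ψ n 1 := by
    intro n
    cases n with
    | zero => linear_combination e1
    | succ k => linear_combination f1 k
  have hv : ∀ n, ψ n 1 = 0 := by
    intro n
    have h3 : ((1 : ℂ) + (b - E) * (b + E)) * ψ n 1 = 0 := by
      linear_combination f0 n - (b - E) * hu n
    exact (mul_eq_zero.mp h3).resolve_left hc
  funext n
  ext i
  fin_cases i
  · cases n with
    | zero => simpa using hu0
    | succ k => simpa [hv k] using hu k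
  · simpa using hv n
end

section
/- Suppose a ≠ 0 and ((a+1)² − (E² − b²))·((a−1)² − (E² − b²)) ≤ 0 (equivalently, the discriminant Δ = ((a+1)² − (E²−b²))((a−1)² − (E²−b²))/a² is ≤ 0). Then the only ℓ²-solution of the half-line eigenvalue equation at energy E is the zero sequence. -/
open Matrix

open Filter Topology in
lemma real_rec_zero (a c : ℝ) (ha : a ≠ 0) (hc : c ^ 2 ≤ 4 * a ^ 2) (u : ℕ → ℝ)
    (hu : ∀ n, a * u (n + 2) + c * u (n + 1) + a * u n = 0)
    (hl : Tendsto u atTop (𝓝 0)) (n : ℕ) : u n = 0 := by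
  obtain ⟨t, rfl⟩ : ∃ t, c = a * t := ⟨c / a, by field_simp⟩
  have ha2 : 0 < a ^ 2 := by positivity
  have ht : t ^ 2 ≤ 2 ^ 2 := by
    by_contra! h
    nlinarith
  have ht' : |t| ≤ 2 := abs_le_of_sq_le_sq ht (by norm_num)
  have hr : ∀ n, u (n + 2) = - t * u (n + 1) - u n := by
    intro n
    have := hu n
    apply mul_left_cancel₀ ha
    linarith
  have hQ : ∀ n, u (n + 1) ^ 2 + t * (u (n + 1) * u n) + u n ^ 2
      = u 1 ^ 2 + t * (u 1 * u 0) + u 0 ^ 2 := by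
    intro n
    induction n with
    | zero => simp
    | succ k ih => rw [← ih, show k + 1 + 1 = k + 2 from rfl, hr k]; ring
  have hl1 : Tendsto (fun n => u (n + 1)) atTop (𝓝 0) := hl.comp (tendsto_add_atTop_nat 1)
  have hQl : Tendsto (fun n => u (n + 1) ^ 2 + t * (u (n + 1) * u n) + u n ^ 2) atTop
      (𝓝 (0 ^ 2 + t * (0 * 0) + 0 ^ 2)) :=
    ((hl1.pow 2).add ((hl1.mul hl).const_mul t)).add (hl.pow 2)
  simp only [hQ] at hQl
  have hQ0 := tendsto_nhds_unique tendsto_const_nhds hQl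
  have hs : ∀ n, |u (n + 1)| = |u n| := by
    intro n
    have h1 := hQ n
    rw [hQ0] at h1
    have h2 : |t * (u (n + 1) * u n)| ≤ 2 * (|u (n + 1)| * |u n|) := by
      rw [abs_mul, abs_mul]
      gcongr
    have h3 := (abs_le.mp h2).1
    have h4 : (|u (n + 1)| - |u n|) ^ 2 ≤ 0 := by
      nlinarith [sq_abs (u (n + 1)), sq_abs (u n)]
    have h5 : |u (n + 1)| - |u n| = 0 := by
      apply pow_eq_zero_iff (two_ne_zero) |>.mp
      exact le_antisymm h4 (sq_nonneg _)
    linarith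
  have hcst : ∀ n, |u n| = |u 0| := by
    intro n
    induction n with
    | zero => rfl
    | succ k ih => rw [hs, ih]
  have hla := hl.abs
  simp only [hcst, abs_zero] at hla
  have := tendsto_nhds_unique tendsto_const_nhds hla
  rw [← abs_eq_zero, hcst, this]

open Filter Topology in
lemma complex_rec_zero (a c : ℝ) (ha : a ≠ 0) (hc : c ^ 2 ≤ 4 * a ^ 2) (u : ℕ → ℂ)
    (hu : ∀ n, (a : ℂ) * u (n + 2) + c * u (n + 1) + a * u n = 0)
    (hl : Tendsto u atTop (𝓝 0)) (n : ℕ) : u n = 0 := by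
  apply Complex.ext
  · refine real_rec_zero a c ha hc (fun n => (u n).re) (fun n => ?_) ?_ n
    · simpa using congrArg Complex.re (hu n)
    · simpa [Function.comp_def] using (Complex.continuous_re.tendsto 0).comp hl
  · refine real_rec_zero a c ha hc (fun n => (u n).im) (fun n => ?_) ?_ n
    · simpa using congrArg Complex.im (hu n)
    · simpa [Function.comp_def] using (Complex.continuous_im.tendsto 0).comp hl

/-- If `a ≠ 0` and the discriminant `((a+1)² - (E²-b²))((a-1)² - (E²-b²))` is `≤ 0`,
then the only ℓ²-solution is the zero sequence. -/
theorem no_L2_solution_nonpositive_discriminant (a b E : ℝ) (ha : a ≠ 0)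
    (hΔ : ((a + 1) ^ 2 - (E ^ 2 - b ^ 2)) * ((a - 1) ^ 2 - (E ^ 2 - b ^ 2)) ≤ 0) :
    ∀ ψ : ℕ → EuclideanSpace ℂ (Fin 2), IsSol a b E ψ → IsL2 ψ → ψ = 0 := by
  intro ψ ⟨h0, h⟩ hL
  have e2 : ∀ n, ψ n 1 + ((b : ℂ) - E) * ψ (n + 1) 0 + a * ψ (n + 1) 1 = 0 := by
    intro n
    have := congrFun (h n) 0
    simp [Amat, Vmat, Matrix.mulVec, dotProduct, Fin.sum_univ_two, Matrix.conjTranspose_apply]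
      at this
    linear_combination this
  have e1 : ∀ n, (a : ℂ) * ψ n 0 - ((b : ℂ) + E) * ψ n 1 + ψ (n + 1) 0 = 0 := by
    intro n
    cases n with
    | zero =>
      have := congrFun h0 1
      simp [Amat, Vmat, Matrix.mulVec, dotProduct, Fin.sum_univ_two, Matrix.conjTranspose_apply]
        at this
      linear_combination this
    | succ n =>
      have := congrFun (h n) 1
      simp [Amat, Vmat, Matrix.mulVec, dotProduct, Fin.sum_univ_two, Matrix.conjTranspose_apply]
        at this
      linear_combination this
  have hn : Filter.Tendsto (fun n => ‖ψ n‖) Filter.atTop (nhds 0) := by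
    have := (hL.tendsto_atTop_zero).sqrt
    simpa using this
  have hi : ∀ i, Filter.Tendsto (fun n => ψ n i) Filter.atTop (nhds 0) := fun i =>
    squeeze_zero_norm (fun n => PiLp.norm_apply_le (ψ n) i) hn
  have hc : (a ^ 2 + b ^ 2 - E ^ 2 + 1) ^ 2 ≤ 4 * a ^ 2 := by nlinarith
  funext n
  ext i
  fin_cases i
  · refine complex_rec_zero a _ ha hc (fun n => ψ n 0) (fun n => ?_) (hi 0) n
    push_cast
    linear_combination ((b : ℂ) + E) * e2 n + e1 n + a * e1 (n + 1)
  · refine complex_rec_zero a _ ha hc (fun n => ψ n 1) (fun n => ?_) (hi 1) n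
    push_cast
    linear_combination a * e2 n + e2 (n + 1) - ((b : ℂ) - E) * e1 (n + 1)
end

section
/- Suppose a ≠ 0, a ≠ 1, a ≠ −1 and E = −b. Then there exists a nonzero ℓ²-solution of the half-line eigenvalue equation at energy E if and only if b = 0 and |a| < 1; and in that case the ℂ-vector space of ℓ²-solutions has dimension 1. -/
open Matrix

theorem isSol_iff (a b E : ℝ) (hE : E = -b) (ψ : ℕ → EuclideanSpace ℂ (Fin 2)) :
    IsSol a b E ψ ↔
      ((2 * b * ψ 0 0 + a * ψ 0 1 = 0 ∧ a * ψ 0 0 + ψ 1 0 = 0) ∧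
        ∀ n, ψ n 1 + 2 * b * ψ (n + 1) 0 + a * ψ (n + 1) 1 = 0 ∧
          a * ψ (n + 1) 0 + ψ (n + 2) 0 = 0) := by
  subst hE
  unfold IsSol Vmat Amat
  simp only [funext_iff, Fin.forall_fin_two]
  simp [dotProduct, Fin.sum_univ_two, Matrix.conjTranspose_apply, ← two_mul, add_assoc]

theorem sol_u (a b E : ℝ) (hE : E = -b) (ψ : ℕ → EuclideanSpace ℂ (Fin 2))
    (h : IsSol a b E ψ) (n : ℕ) : ψ n 0 = (-(a : ℂ)) ^ n * ψ 0 0 := by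
  rw [isSol_iff a b E hE] at h
  obtain ⟨⟨_, h1⟩, h2⟩ := h
  have hs : ∀ n, ψ (n + 1) 0 = -(a : ℂ) * ψ n 0 := by
    intro n
    cases n with
    | zero => linear_combination h1
    | succ k => linear_combination (h2 k).2
  induction n with
  | zero => simp
  | succ k ih => rw [hs, ih]; ring

theorem sol_d (a b E : ℝ) (hE : E = -b) (ψ : ℕ → EuclideanSpace ℂ (Fin 2))
    (h : IsSol a b E ψ) (n : ℕ) :
    a * ((-(a : ℂ)) ^ n * ((1 - (a : ℂ) ^ 2) * ψ n 1 - 2 * a * b * ψ n 0)) =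
      -2 * b * ψ 0 0 := by
  have hu := sol_u a b E hE ψ h
  rw [isSol_iff a b E hE] at h
  obtain ⟨⟨h0, h1⟩, h2⟩ := h
  induction n with
  | zero => linear_combination (1 - (a : ℂ) ^ 2) * h0
  | succ k ih =>
    rw [← ih]
    have e1 := (h2 k).1
    have e2 : ψ (k + 1) 0 = -(a : ℂ) * ψ k 0 := by rw [hu (k + 1), hu k]; ring
    rw [e2] at e1 ⊢
    rw [pow_succ]
    linear_combination (-(a : ℂ)) ^ k * (-(a : ℂ)) * (1 - (a : ℂ) ^ 2) * e1

theorem l2_tendsto (ψ : ℕ → EuclideanSpace ℂ (Fin 2)) (h : IsL2 ψ) (i : Fin 2) :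
    Filter.Tendsto (fun n => ψ n i) Filter.atTop (nhds 0) := by
  have h1 := h.tendsto_atTop_zero
  have h2 : Filter.Tendsto (fun n => ‖ψ n‖) Filter.atTop (nhds 0) := by
    have := (Real.continuous_sqrt.tendsto 0).comp h1
    simpa [Function.comp_def, Real.sqrt_sq] using this
  exact squeeze_zero_norm (fun n => PiLp.norm_apply_le (ψ n) i) h2

theorem sol_zero (a b E : ℝ) (ha : a ≠ 0) (hE : E = -b) (ψ : ℕ → EuclideanSpace ℂ (Fin 2))
    (h : IsSol a b E ψ) (h0 : b = 0 ∨ ψ 0 0 = 0) (n : ℕ) : ψ n 1 = 0 := by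
  have hu := sol_u a b E hE ψ h
  rw [isSol_iff a b E hE] at h
  obtain ⟨⟨h3, h1⟩, h2⟩ := h
  have hb : ∀ n, (b : ℂ) * ψ n 0 = 0 := by
    intro n
    rcases h0 with h0 | h0
    · simp [h0]
    · simp [hu n, h0]
  have ha' : (a : ℂ) ≠ 0 := by exact_mod_cast ha
  induction n with
  | zero =>
    refine (mul_eq_zero.1 (?_ : (a : ℂ) * ψ 0 1 = 0)).resolve_left ha'
    linear_combination h3 - 2 * hb 0
  | succ k ih =>
    refine (mul_eq_zero.1 (?_ : (a : ℂ) * ψ (k + 1) 1 = 0)).resolve_left ha'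
    linear_combination (h2 k).1 - 2 * hb (k + 1) - ih

theorem exists_sol (a b E : ℝ) (hE : E = -b) (hb : b = 0) (ha : |a| < 1) :
    ∃ ψ₀ : ℕ → EuclideanSpace ℂ (Fin 2), ψ₀ 0 0 = 1 ∧ IsSol a b E ψ₀ ∧ IsL2 ψ₀ := by
  refine ⟨fun n => !₂[(-(a : ℂ)) ^ n, 0], by simp, ?_, ?_⟩
  · rw [isSol_iff a b E hE]
    subst hb
    simp
    intro n
    ring
  · unfold IsL2
    have : ∀ n : ℕ, ‖(!₂[(-(a : ℂ)) ^ n, 0] : EuclideanSpace ℂ (Fin 2))‖ ^ 2 = (a ^ 2) ^ n := by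
      intro n
      rw [EuclideanSpace.norm_sq_eq]
      simp [Fin.sum_univ_two, ← pow_mul]
      rw [mul_comm, pow_mul, pow_mul, sq_abs]
    simp only [this]
    apply summable_geometric_of_lt_one (sq_nonneg a)
    rwa [sq_lt_one_iff_abs_lt_one]

/-- For `a ≠ 0, ±1` and `E = -b`: a nonzero ℓ²-solution exists iff `b = 0` and `|a| < 1`,
in which case the space of ℓ²-solutions has dimension 1. -/
theorem L2_solution_E_eq_neg_b (a b E : ℝ) (ha : a ≠ 0) (ha1 : a ≠ 1) (ha1' : a ≠ -1)
    (hE : E = -b) :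
    ((∃ ψ : ℕ → EuclideanSpace ℂ (Fin 2), IsSol a b E ψ ∧ IsL2 ψ ∧ ψ ≠ 0) ↔
      (b = 0 ∧ |a| < 1)) ∧
    (b = 0 → |a| < 1 →
      ∃ ψ₀ : ℕ → EuclideanSpace ℂ (Fin 2), ψ₀ ≠ 0 ∧ IsSol a b E ψ₀ ∧ IsL2 ψ₀ ∧
        ∀ ψ : ℕ → EuclideanSpace ℂ (Fin 2), IsSol a b E ψ → IsL2 ψ →
          ∃ c : ℂ, ψ = c • ψ₀) := by
  have hne : ∀ ψ : ℕ → EuclideanSpace ℂ (Fin 2), ψ 0 0 = 1 → ψ ≠ 0 := by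
    rintro ψ h rfl
    simp at h
  refine ⟨⟨?_, ?_⟩, ?_⟩
  · rintro ⟨ψ, hs, hl, hn⟩
    have hu := sol_u a b E hE ψ hs
    have h00 : ψ 0 0 ≠ 0 := by
      intro h0
      apply hn
      ext n i
      fin_cases i
      · simp [hu n, h0]
      · simpa using sol_zero a b E ha hE ψ hs (Or.inr h0) n
    have t0 := l2_tendsto ψ hl 0
    have t1 := l2_tendsto ψ hl 1
    have tp : Filter.Tendsto (fun n : ℕ => (-(a : ℂ)) ^ n) Filter.atTop (nhds 0) := by
      have := t0.mul_const (ψ 0 0)⁻¹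
      rw [zero_mul] at this
      refine this.congr fun n => ?_
      rw [hu n]
      field_simp
    have hlt : |a| < 1 := by
      have := tendsto_pow_atTop_nhds_zero_iff_norm_lt_one.1 tp
      simpa using this
    refine ⟨?_, hlt⟩
    have td := (tp.mul ((t1.const_mul (1 - (a : ℂ) ^ 2)).sub
      (t0.const_mul (2 * (a : ℂ) * b)))).const_mul (a : ℂ)
    simp only [sol_d a b E hE ψ hs] at td
    simpa [h00] using tendsto_nhds_unique tendsto_const_nhds td
  · rintro ⟨hb, hlt⟩
    obtain ⟨ψ, h1, h2, h3⟩ := exists_sol a b E hE hb hlt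
    exact ⟨ψ, h2, h3, hne ψ h1⟩
  · intro hb hlt
    obtain ⟨ψ₀, h1, h2, h3⟩ := exists_sol a b E hE hb hlt
    refine ⟨ψ₀, hne _ h1, h2, h3, fun ψ hs _ => ⟨ψ 0 0, ?_⟩⟩
    ext n i
    fin_cases i
    · simp [sol_u a b E hE ψ hs n, sol_u a b E hE ψ₀ h2 n, h1, mul_comm]
    · simp [sol_zero a b E ha hE ψ hs (Or.inl hb) n, sol_zero a b E ha hE ψ₀ h2 (Or.inl hb) n]
end

section
/- Let a, b be real numbers and let T be any continuous linear endomorphism of the Hilbert space ℓ²(ℕ, ℂ²) such that for every ψ ∈ ℓ²(ℕ, ℂ²): (Tψ)(0) = Vψ(0) + A*ψ(1) and (Tψ)(n) = Aψ(n−1) + Vψ(n) + A*ψ(n+1) for all n ≥ 1. Then 0 belongs to the spectrum of T if and only if b = 0 and |a| ≤ 1. -/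
open Matrix

noncomputable section

/-- The Hilbert space `ℓ²(ℕ, ℂ²)`. -/
abbrev H2 : Type := lp (fun _ : ℕ => EuclideanSpace ℂ (Fin 2)) 2

end

open Filter Topology ComplexConjugate

/-- first component -/
noncomputable def cx (ψ : H2) (n : ℕ) : ℂ := (ψ : ∀ _ : ℕ, EuclideanSpace ℂ (Fin 2)) n 0

/-- second component -/
noncomputable def cy (ψ : H2) (n : ℕ) : ℂ := (ψ : ∀ _ : ℕ, EuclideanSpace ℂ (Fin 2)) n 1

/-- second component, shifted -/
noncomputable def cp (ψ : H2) : ℕ → ℂ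
  | 0 => 0
  | n + 1 => cy ψ n

lemma cp_succ (ψ : H2) (n : ℕ) : cp ψ (n + 1) = cy ψ n := rfl

lemma norm_sq_site (ψ : H2) (n : ℕ) :
    ‖(ψ : ∀ _ : ℕ, EuclideanSpace ℂ (Fin 2)) n‖ ^ 2 = ‖cx ψ n‖ ^ 2 + ‖cy ψ n‖ ^ 2 := by
  rw [EuclideanSpace.norm_sq_eq, Fin.sum_univ_two]; rfl

lemma hasSum_sites (ψ : H2) :
    HasSum (fun n => ‖cx ψ n‖ ^ 2 + ‖cy ψ n‖ ^ 2) (‖ψ‖ ^ 2) := by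
  have h := lp.hasSum_norm (p := 2) (by norm_num) ψ
  simp only [ENNReal.toReal_ofNat, Real.rpow_ofNat] at h
  simpa only [norm_sq_site] using h

lemma tendsto_sites (ψ : H2) :
    Tendsto (fun n => ‖cx ψ n‖ ^ 2 + ‖cy ψ n‖ ^ 2) atTop (𝓝 0) :=
  (hasSum_sites ψ).summable.tendsto_atTop_zero

lemma tendsto_of_sq {f : ℕ → ℂ} {g : ℕ → ℝ} (hg : Tendsto g atTop (𝓝 0))
    (h : ∀ n, ‖f n‖ ^ 2 ≤ g n) : Tendsto f atTop (𝓝 0) := by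
  have h1 : Tendsto (fun n => ‖f n‖ ^ 2) atTop (𝓝 0) :=
    squeeze_zero (fun n => by positivity) h hg
  have h2 := h1.sqrt
  simp only [Real.sqrt_zero, Real.sqrt_sq (norm_nonneg _)] at h2
  exact tendsto_zero_iff_norm_tendsto_zero.2 h2

lemma tendsto_cx (ψ : H2) : Tendsto (cx ψ) atTop (𝓝 0) :=
  tendsto_of_sq (tendsto_sites ψ) fun n => by nlinarith [sq_nonneg ‖cy ψ n‖]

lemma tendsto_cy (ψ : H2) : Tendsto (cy ψ) atTop (𝓝 0) :=
  tendsto_of_sq (tendsto_sites ψ) fun n => by nlinarith [sq_nonneg ‖cx ψ n‖]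

lemma tendsto_cp (ψ : H2) : Tendsto (cp ψ) atTop (𝓝 0) :=
  (tendsto_add_atTop_iff_nat 1).1 (tendsto_cy ψ)

/-- componentwise form of the operator -/
def IsOp (a b : ℝ) (T : H2 →L[ℂ] H2) : Prop :=
  ∀ ψ n, cx (T ψ) n = b * cx ψ n + a * cy ψ n + cp ψ n ∧
    cy (T ψ) n = a * cx ψ n - b * cy ψ n + cx ψ (n + 1)

lemma lower_bound_of {T : H2 →L[ℂ] H2} {c : ℝ} (ψ : H2) (q : ℕ → ℝ) (q0 : 0 ≤ q 0)
    (hq : Tendsto q atTop (𝓝 0))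
    (h : ∀ n, c * (‖cx ψ n‖ ^ 2 + ‖cy ψ n‖ ^ 2) + (q n - q (n + 1)) ≤
      ‖cx (T ψ) n‖ ^ 2 + ‖cy (T ψ) n‖ ^ 2) : c * ‖ψ‖ ^ 2 ≤ ‖T ψ‖ ^ 2 := by
  have h1 := ((hasSum_sites ψ).mul_left c).tendsto_sum_nat.sub hq
  have h2 := (hasSum_sites (T ψ)).tendsto_sum_nat
  rw [sub_zero] at h1
  refine le_of_tendsto_of_tendsto' h1 h2 fun N => ?_
  have h3 := Finset.sum_le_sum fun n (_ : n ∈ Finset.range N) => h n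
  rw [Finset.sum_add_distrib, Finset.sum_range_sub'] at h3
  linarith

lemma IsOp.symm {a b : ℝ} {T : H2 →L[ℂ] H2} (hT : IsOp a b T) (φ ψ : H2) :
    inner ℂ (T φ) ψ = inner ℂ φ (T ψ) := by
  have h1 := ((lp.hasSum_inner (𝕜 := ℂ) (T φ) ψ).sub
    (lp.hasSum_inner (𝕜 := ℂ) φ (T ψ))).tendsto_sum_nat
  let d : ℕ → ℂ := fun n => conj (cp φ n) * cx ψ n - conj (cx φ n) * cp ψ n
  have hd : Tendsto d atTop (𝓝 0) := by
    have hc : ∀ {f : ℕ → ℂ}, Tendsto f atTop (𝓝 0) →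
        Tendsto (fun n => conj (f n)) atTop (𝓝 0) := fun {f} hf => by
      have := (Complex.continuous_conj.tendsto 0).comp hf
      rw [map_zero] at this
      exact this
    have := ((hc (tendsto_cp φ)).mul (tendsto_cx ψ)).sub
      ((hc (tendsto_cx φ)).mul (tendsto_cp ψ))
    simpa using this
  have key : ∀ n, inner ℂ ((T φ : ∀ _ : ℕ, EuclideanSpace ℂ (Fin 2)) n)
      ((ψ : ∀ _ : ℕ, EuclideanSpace ℂ (Fin 2)) n) -
      inner ℂ ((φ : ∀ _ : ℕ, EuclideanSpace ℂ (Fin 2)) n)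
      ((T ψ : ∀ _ : ℕ, EuclideanSpace ℂ (Fin 2)) n) = d n - d (n + 1) := by
    intro n
    have e : ∀ u v : H2, inner ℂ ((u : ∀ _ : ℕ, EuclideanSpace ℂ (Fin 2)) n)
      ((v : ∀ _ : ℕ, EuclideanSpace ℂ (Fin 2)) n) =
        cx v n * conj (cx u n) + cy v n * conj (cy u n) := fun u v => by
      rw [PiLp.inner_apply, Fin.sum_univ_two]; rfl
    rw [e, e, (hT φ n).1, (hT φ n).2, (hT ψ n).1, (hT ψ n).2]
    simp only [d, cp, map_add, map_sub, map_mul, Complex.conj_ofReal]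
    ring
  simp only [key, Finset.sum_range_sub'] at h1
  have h2 : Tendsto (fun n => d 0 - d n) atTop (𝓝 (d 0 - 0)) := hd.const_sub (d 0)
  have h3 := tendsto_nhds_unique h1 h2
  have d0 : d 0 = 0 := by simp [d, cp]
  rw [d0, sub_zero] at h3
  exact sub_eq_zero.1 h3

lemma IsOp.isUnit {a b : ℝ} {T : H2 →L[ℂ] H2} (hT : IsOp a b T) {c : ℝ} (hc : 0 < c)
    (h : ∀ ψ, c * ‖ψ‖ ^ 2 ≤ ‖T ψ‖ ^ 2) : IsUnit T := by
  rw [← isUnit_pow_iff (n := 2) two_ne_zero]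
  refine ContinuousLinearMap.isUnit_of_forall_le_norm_inner_map (𝕜 := ℂ) (T ^ 2)
    (c := ⟨c, hc.le⟩) hc fun ψ => ?_
  have e : inner ℂ ((T ^ 2) ψ) ψ = inner ℂ (T ψ) (T ψ) := by
    rw [pow_two]; exact hT.symm (T ψ) ψ
  rw [e, inner_self_eq_norm_sq_to_K, norm_pow]
  have h1 : ‖ψ‖ ^ 2 * c ≤ ‖T ψ‖ ^ 2 := by rw [mul_comm]; exact h ψ
  refine le_trans (show _ ≤ ‖T ψ‖ ^ 2 from h1) (le_of_eq ?_)
  simp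

lemma IsOp.isUnit_of_b {a b : ℝ} {T : H2 →L[ℂ] H2} (hT : IsOp a b T) (hb : b ≠ 0) :
    IsUnit T := by
  refine hT.isUnit (c := b ^ 2) (by positivity) fun ψ => ?_
  refine lower_bound_of ψ
    (fun n => 2 * b * (conj (cx ψ n) * cp ψ n).re) (by simp [cp]) ?_ fun n => ?_
  · have h1 := (Complex.continuous_conj.tendsto 0).comp (tendsto_cx ψ)
    have h2 := (Complex.continuous_re.tendsto _).comp (h1.mul (tendsto_cp ψ))
    simpa using h2.const_mul (2 * b)
  · rw [(hT ψ n).1, (hT ψ n).2]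
    simp only [cp_succ, Complex.sq_norm, Complex.normSq_apply]
    simp
    generalize cx ψ n = x
    generalize cx ψ (n + 1) = x'
    generalize cy ψ n = y
    generalize cp ψ n = p
    nlinarith [sq_nonneg (a * y.re + p.re), sq_nonneg (a * y.im + p.im),
      sq_nonneg (a * x.re + x'.re), sq_nonneg (a * x.im + x'.im)]

lemma aux_bound (a : ℝ) (y p : ℂ) :
    (|a| - 1) ^ 2 * ‖y‖ ^ 2 + (|a| - 1) * (‖y‖ ^ 2 - ‖p‖ ^ 2) ≤ ‖a * y + p‖ ^ 2 := by
  have h1 := abs_norm_sub_norm_le (a * y) (-p)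
  rw [norm_neg, sub_neg_eq_add, norm_mul, Complex.norm_real, Real.norm_eq_abs] at h1
  have h2 : (|a| * ‖y‖ - ‖p‖) ^ 2 ≤ ‖a * y + p‖ ^ 2 := by
    rw [← sq_abs]; gcongr
  nlinarith [mul_nonneg (abs_nonneg a) (sq_nonneg (‖y‖ - ‖p‖))]

lemma IsOp.isUnit_of_a {a : ℝ} {T : H2 →L[ℂ] H2} (hT : IsOp a 0 T) (ha : 1 < |a|) :
    IsUnit T := by
  have ha' : 0 < |a| - 1 := by linarith
  refine hT.isUnit (c := (|a| - 1) ^ 2) (by positivity) fun ψ => ?_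
  refine lower_bound_of ψ
    (fun n => (|a| - 1) * (‖cx ψ n‖ ^ 2 - ‖cp ψ n‖ ^ 2)) ?_ ?_ fun n => ?_
  · simp only [cp, norm_zero]; nlinarith [mul_nonneg ha'.le (sq_nonneg ‖cx ψ 0‖)]
  · have h1 := ((tendsto_cx ψ).norm.pow 2).sub ((tendsto_cp ψ).norm.pow 2)
    simpa using h1.const_mul (|a| - 1)
  · rw [(hT ψ n).1, (hT ψ n).2]
    have h1 := aux_bound a (cy ψ n) (cp ψ n)
    have h2 := aux_bound a (cx ψ n) (cx ψ (n + 1))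
    simp only [Complex.ofReal_zero, zero_mul, zero_add, sub_zero]
    simp only [cp_succ]
    linarith

lemma IsOp.not_isUnit {a : ℝ} {T : H2 →L[ℂ] H2} (hT : IsOp a 0 T) (ha : |a| ≤ 1) :
    ¬ IsUnit T := by
  rintro ⟨u, rfl⟩
  let e : H2 := lp.single 2 0 (WithLp.toLp 2 ![1, 0])
  let φ : H2 := (↑u⁻¹ : H2 →L[ℂ] H2) e
  have hφ : (u : H2 →L[ℂ] H2) φ = e := by
    change ((u : H2 →L[ℂ] H2) * (↑u⁻¹ : H2 →L[ℂ] H2)) e = e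
    rw [Units.mul_inv]; rfl
  have h0 : a * cy φ 0 = 1 := by
    have := (hT φ 0).1
    rw [hφ] at this
    simpa [cx, cp, e] using this.symm
  have hs : ∀ n, a * cy φ (n + 1) + cy φ n = 0 := by
    intro n
    have := (hT φ (n + 1)).1
    rw [hφ] at this
    simpa [cx, cp, e] using this.symm
  have hm : Monotone fun n => ‖cy φ n‖ := by
    refine monotone_nat_of_le_succ fun n => ?_
    have h1 : cy φ n = -(a * cy φ (n + 1)) := by linear_combination hs n
    rw [h1, norm_neg, norm_mul, Complex.norm_real, Real.norm_eq_abs]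
    nlinarith [norm_nonneg (cy φ (n + 1))]
  have ht : Tendsto (fun n => ‖cy φ n‖) atTop (𝓝 0) := by
    simpa using (tendsto_cy φ).norm
  have h1 : ‖cy φ 0‖ ≤ 0 := hm.ge_of_tendsto ht 0
  have h2 : cy φ 0 = 0 := norm_le_zero_iff.1 h1
  simp [h2] at h0

/-- For the half-line tight-binding operator `T` on `ℓ²(ℕ, ℂ²)` given by
`(Tψ)(0) = Vψ(0) + A*ψ(1)` and `(Tψ)(n) = Aψ(n-1) + Vψ(n) + A*ψ(n+1)` for `n ≥ 1`,
zero belongs to the spectrum of `T` iff `b = 0` and `|a| ≤ 1`. -/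
theorem zero_in_spectrum_iff (a b : ℝ) (T : H2 →L[ℂ] H2)
    (hT0 : ∀ ψ : H2,
      (T ψ : ∀ _ : ℕ, EuclideanSpace ℂ (Fin 2)) 0 =
        (Vmat a b).mulVec ((ψ : ∀ _ : ℕ, EuclideanSpace ℂ (Fin 2)) 0)
          + (Amat)ᴴ.mulVec ((ψ : ∀ _ : ℕ, EuclideanSpace ℂ (Fin 2)) 1))
    (hT : ∀ ψ : H2, ∀ n : ℕ,
      (T ψ : ∀ _ : ℕ, EuclideanSpace ℂ (Fin 2)) (n + 1) =
        Amat.mulVec ((ψ : ∀ _ : ℕ, EuclideanSpace ℂ (Fin 2)) n)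
          + (Vmat a b).mulVec ((ψ : ∀ _ : ℕ, EuclideanSpace ℂ (Fin 2)) (n + 1))
          + (Amat)ᴴ.mulVec ((ψ : ∀ _ : ℕ, EuclideanSpace ℂ (Fin 2)) (n + 2))) :
    (0 : ℂ) ∈ spectrum ℂ T ↔ (b = 0 ∧ |a| ≤ 1) := by
  have hop : IsOp a b T := by
    intro ψ n
    cases n with
    | zero =>
      have h := hT0 ψ
      have h0 := congrFun h 0
      have h1 := congrFun h 1
      simp [Vmat, Amat, Matrix.mulVec, dotProduct, Fin.sum_univ_two] at h0 h1
      refine ⟨?_, ?_⟩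
      · simp only [cx, cy, cp, h0]; ring
      · simp only [cx, cy, h1]; ring
    | succ n =>
      have h := hT ψ n
      have h0 := congrFun h 0
      have h1 := congrFun h 1
      simp [Vmat, Amat, Matrix.mulVec, dotProduct, Fin.sum_univ_two] at h0 h1
      refine ⟨?_, ?_⟩
      · simp only [cx, cy, cp, h0]; ring
      · simp only [cx, cy, h1]; ring
  rw [spectrum.zero_mem_iff]
  constructor
  · intro h
    have hb : b = 0 := by
      by_contra hb
      exact h (hop.isUnit_of_b hb)
    subst hb
    refine ⟨rfl, ?_⟩
    by_contra ha
    exact h (hop.isUnit_of_a (not_le.1 ha))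
  · rintro ⟨rfl, ha⟩
    exact hop.not_isUnit ha
end

section
/- Let r ≥ 1 and 0 < p < r be integers. Then the space Herm_p(ℂ^r) is path-connected. -/
open Matrix

/-- `Herm_p(ℂ^r)`: the set of `r × r` complex matrices that are Hermitian, invertible,
and have exactly `p` negative and `r - p` positive eigenvalues (with multiplicity). -/
def HermP (r p : ℕ) : Set (Matrix (Fin r) (Fin r) ℂ) :=
  {M | IsUnit M ∧ ∃ hM : M.IsHermitian,
    (Finset.univ.filter fun i => hM.eigenvalues i < 0).card = p ∧
    (Finset.univ.filter fun i => 0 < hM.eigenvalues i).card = r - p}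

open scoped Matrix.Norms.L2Operator in
lemma hermP_unitary_joined {r : ℕ} (U : unitary (Matrix (Fin r) (Fin r) ℂ)) :
    ∃ W : unitary (Matrix (Fin r) (Fin r) ℂ),
      (∀ X : Matrix (Fin r) (Fin r) ℂ, (W : Matrix (Fin r) (Fin r) ℂ) * X * star (W : Matrix (Fin r) (Fin r) ℂ)
        = (U : Matrix (Fin r) (Fin r) ℂ) * X * star (U : Matrix (Fin r) (Fin r) ℂ)) ∧ Joined 1 W := by
  have hfin : (spectrum ℂ (U : Matrix (Fin r) (Fin r) ℂ)).Finite := Matrix.finite_spectrum _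
  have hinf : (Metric.sphere (0 : ℂ) 1).Infinite := by
    have hc : IsPreconnected (Metric.sphere (0 : ℂ) 1) :=
      isPreconnected_sphere (by simp) 0 1
    refine hc.infinite_of_nontrivial ⟨1, by simp, -1, by simp, ?_⟩
    norm_num
  obtain ⟨z, hz, hzU⟩ := (hinf.sdiff hfin).nonempty
  have hz1 : ‖z‖ = 1 := by simpa using hz
  have hz0 : z ≠ 0 := by rintro rfl; simp at hz1
  have hzz : star z * z = 1 := by
    have := Complex.conj_mul' z
    simpa [hz1] using this
  have hzz' : z * star z = 1 := by rw [mul_comm]; exact hzz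
  have hconj : ∀ X : Matrix (Fin r) (Fin r) ℂ,
      ((-star z) • (U : Matrix (Fin r) (Fin r) ℂ)) * X * star ((-star z) • (U : Matrix (Fin r) (Fin r) ℂ))
        = (U : Matrix (Fin r) (Fin r) ℂ) * X * star (U : Matrix (Fin r) (Fin r) ℂ) := by
    intro X
    rw [star_smul, smul_mul_assoc, smul_mul_assoc, mul_smul_comm, smul_smul]
    simp only [star_neg, star_star, neg_mul_neg, hzz, one_smul]
  have hmem : (-star z) • (U : Matrix (Fin r) (Fin r) ℂ) ∈ unitary (Matrix (Fin r) (Fin r) ℂ) := by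
    rw [Unitary.mem_iff]
    constructor
    · rw [star_smul, smul_mul_assoc, mul_smul_comm, smul_smul]
      simp only [star_neg, star_star, neg_mul_neg, hzz', one_smul]
      exact Unitary.coe_star_mul_self U
    · simpa using hconj 1
  refine ⟨⟨_, hmem⟩, hconj, Unitary.joined _ _ ?_⟩
  have := (Unitary.norm_sub_one_lt_two_iff hmem).2 ?_
  · simpa using this
  intro h
  apply hzU
  rw [spectrum.mem_iff] at h ⊢
  intro hu
  apply h
  have : (algebraMap ℂ (Matrix (Fin r) (Fin r) ℂ)) (-1) - (-star z) • (U : Matrix (Fin r) (Fin r) ℂ)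
      = (algebraMap ℂ (Matrix (Fin r) (Fin r) ℂ) (-star z)) * (algebraMap ℂ (Matrix (Fin r) (Fin r) ℂ) z - U) := by
    rw [mul_sub, ← map_mul, neg_mul, hzz, Algebra.smul_def]
  rw [this]
  refine IsUnit.mul (IsUnit.map _ ?_) hu
  simpa using hz0

/-- Unitary conjugates of real diagonal matrices with the right sign counts lie in `HermP`. -/
lemma hermP_mem_conj {r p : ℕ} (hpr : p < r) (W : unitary (Matrix (Fin r) (Fin r) ℂ))
    (d : Fin r → ℝ) (h1 : (Finset.univ.filter fun i => d i < 0).card = p)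
    (h2 : (Finset.univ.filter fun i => 0 < d i).card = r - p) :
    (W : Matrix (Fin r) (Fin r) ℂ) * diagonal (fun i => (d i : ℂ)) *
      star (W : Matrix (Fin r) (Fin r) ℂ) ∈ HermP r p := by
  have hW : star (W : Matrix (Fin r) (Fin r) ℂ) * W = 1 := Unitary.coe_star_mul_self W
  have hH : ((W : Matrix (Fin r) (Fin r) ℂ) * diagonal (fun i => (d i : ℂ)) *
      star (W : Matrix (Fin r) (Fin r) ℂ)).IsHermitian := by
    apply Matrix.isHermitian_mul_mul_conjTranspose
    apply Matrix.isHermitian_diagonal_of_self_adjoint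
    ext i
    simp
  have hroots : Multiset.map (fun i => ((hH.eigenvalues i : ℝ) : ℂ)) Finset.univ.val
      = Multiset.map (fun i => (d i : ℂ)) Finset.univ.val := by
    have e := hH.roots_charpoly_eq_eigenvalues
    rw [Matrix.charpoly_mul_comm, ← mul_assoc, hW, one_mul, charpoly_diagonal,
      Polynomial.roots_prod _ _ (by simp [Finset.prod_ne_zero_iff, Polynomial.X_sub_C_ne_zero])] at e
    simpa [Function.comp_def] using e.symm
  have hms : Multiset.map hH.eigenvalues Finset.univ.val = Multiset.map d Finset.univ.val := by
    have := congrArg (Multiset.map Complex.re) hroots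
    simpa [Multiset.map_map, Function.comp_def] using this
  have hcard : ∀ (P : ℝ → Prop) [DecidablePred P],
      (Finset.univ.filter fun i => P (hH.eigenvalues i)).card
        = (Finset.univ.filter fun i => P (d i)).card := by
    intro P _
    have := congrArg (Multiset.countP P) hms
    rw [Multiset.countP_map, Multiset.countP_map] at this
    exact this
  refine ⟨?_, hH, (hcard (· < 0)).trans h1, (hcard (0 < ·)).trans h2⟩
  have hd0 : ∀ i, d i ≠ 0 := by
    have hdisj : Disjoint (Finset.univ.filter fun i => d i < 0)
        (Finset.univ.filter fun i => 0 < d i) := by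
      rw [Finset.disjoint_filter]
      intro i _ h h'
      exact lt_asymm h h'
    have hu := Finset.card_union_of_disjoint hdisj
    rw [h1, h2] at hu
    have hu2 := Finset.eq_univ_of_card _ (hu.trans (by simp; omega))
    intro i hi
    have := Finset.mem_univ i
    rw [← hu2] at this
    simp [hi] at this
  rw [Matrix.isUnit_iff_isUnit_det, Matrix.det_mul_comm, ← mul_assoc, hW, one_mul, det_diagonal]
  rw [isUnit_iff_ne_zero, Finset.prod_ne_zero_iff]
  intro i _
  exact_mod_cast hd0 i

/-- Since eigenvalues are sorted, membership in `HermP` pins down the signs. -/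
lemma hermP_neg_iff {r : ℕ} {M N : Matrix (Fin r) (Fin r) ℂ} (hM : M.IsHermitian)
    (hN : N.IsHermitian) (P : ℝ → Prop) [DecidablePred P]
    (hP : (∀ a b, a ≤ b → P a → P b) ∨ (∀ a b, a ≤ b → P b → P a))
    (h : (Finset.univ.filter fun i => P (hM.eigenvalues i)).card
      = (Finset.univ.filter fun i => P (hN.eigenvalues i)).card) (i : Fin r) :
    P (hM.eigenvalues i) ↔ P (hN.eigenvalues i) := by
  have key : (Finset.univ.filter fun i => P (hM.eigenvalues i)) ⊆
        (Finset.univ.filter fun i => P (hN.eigenvalues i)) ∨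
      (Finset.univ.filter fun i => P (hN.eigenvalues i)) ⊆
        (Finset.univ.filter fun i => P (hM.eigenvalues i)) := by
    by_contra! hc
    obtain ⟨h1, h2⟩ := hc
    rw [Finset.not_subset] at h1 h2
    obtain ⟨i, hi, hi'⟩ := h1
    obtain ⟨j, hj, hj'⟩ := h2
    simp only [Finset.mem_filter, Finset.mem_univ, true_and] at hi hi' hj hj'
    unfold IsHermitian.eigenvalues at hi hi' hj hj'
    generalize (Fintype.equivOfCardEq (Fintype.card_fin _)).symm i = i at *
    generalize (Fintype.equivOfCardEq (Fintype.card_fin _)).symm j = j at *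
    rcases hP with hP | hP <;> rcases le_total i j with hij | hij
    · exact hi' (hP _ _ (hN.eigenvalues₀_antitone hij) hj)
    · exact hj' (hP _ _ (hM.eigenvalues₀_antitone hij) hi)
    · exact hj' (hP _ _ (hM.eigenvalues₀_antitone hij) hi)
    · exact hi' (hP _ _ (hN.eigenvalues₀_antitone hij) hj)
  have heq : (Finset.univ.filter fun i => P (hM.eigenvalues i)) =
        (Finset.univ.filter fun i => P (hN.eigenvalues i)) := by
    rcases key with k | k
    · exact Finset.eq_of_subset_of_card_le k h.ge
    · exact (Finset.eq_of_subset_of_card_le k h.le).symm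
  simpa using Finset.ext_iff.1 heq i

lemma hermP_joined_diag {r p : ℕ} (hpr : p < r) {M : Matrix (Fin r) (Fin r) ℂ}
    (hM : M.IsHermitian) (h1 : (Finset.univ.filter fun i => hM.eigenvalues i < 0).card = p)
    (h2 : (Finset.univ.filter fun i => 0 < hM.eigenvalues i).card = r - p) :
    JoinedIn (HermP r p) (diagonal fun i => (hM.eigenvalues i : ℂ)) M := by
  obtain ⟨W, hW, ⟨γ⟩⟩ := hermP_unitary_joined hM.eigenvectorUnitary
  have hsp := hM.spectral_theorem
  rw [Unitary.conjStarAlgAut_apply, ← hW] at hsp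
  refine ⟨⟨⟨fun t => (γ t : Matrix (Fin r) (Fin r) ℂ) * (diagonal fun i => (hM.eigenvalues i : ℂ)) *
      star (γ t : Matrix (Fin r) (Fin r) ℂ), ?_⟩, ?_, ?_⟩, ?_⟩
  · have : Continuous fun t => (γ t : Matrix (Fin r) (Fin r) ℂ) :=
      continuous_subtype_val.comp γ.continuous
    exact (this.mul continuous_const).mul this.star
  · simp
  · simp only [γ.target]
    exact hsp.symm
  · intro t
    exact hermP_mem_conj hpr (γ t) _ h1 h2

/-- For `0 < p < r`, the space `Herm_p(ℂ^r)` is path-connected. -/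
theorem hermP_pathConnected (r p : ℕ) (hr : 1 ≤ r) (hp : 0 < p) (hpr : p < r) :
    IsPathConnected (HermP r p) := by
  rw [isPathConnected_iff]
  constructor
  · refine ⟨_, hermP_mem_conj hpr 1 (fun i => if (i : ℕ) < p then -1 else 1) ?_ ?_⟩
    · have : (Finset.univ.filter fun i : Fin r => (if (i : ℕ) < p then (-1 : ℝ) else 1) < 0)
          = Finset.univ.filter fun i : Fin r => (i : ℕ) < p := by
        ext i; by_cases h : (i : ℕ) < p <;> simp [h]
      rw [this, Fin.card_filter_val_lt]; omega
    · have : (Finset.univ.filter fun i : Fin r => 0 < (if (i : ℕ) < p then (-1 : ℝ) else 1))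
          = Finset.univ.filter fun i : Fin r => ¬ (i : ℕ) < p := by
        ext i
        simp only [Finset.mem_filter, Finset.mem_univ, true_and]
        split_ifs with h
        · exact ⟨fun h0 => absurd h0 (by norm_num), fun h0 => absurd h h0⟩
        · exact ⟨fun _ => h, fun _ => one_pos⟩
      have h3 := Finset.card_filter_add_card_filter_not (s := Finset.univ) (fun i : Fin r => (i : ℕ) < p)
      rw [Fin.card_filter_val_lt, Finset.card_univ, Fintype.card_fin] at h3
      rw [this]; omega
  · rintro M ⟨-, hM, m1, m2⟩ N ⟨-, hN, n1, n2⟩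
    refine (hermP_joined_diag hpr hM m1 m2).symm.trans
      (JoinedIn.trans ?_ (hermP_joined_diag hpr hN n1 n2))
    have hneg := hermP_neg_iff hM hN (· < 0) (Or.inr fun a b => lt_of_le_of_lt) (m1.trans n1.symm)
    have hpos := hermP_neg_iff hM hN (0 < ·) (Or.inl fun a b h h' => lt_of_lt_of_le h' h)
      (m2.trans n2.symm)
    let d : unitInterval → Fin r → ℝ := fun t i =>
      (1 - (t : ℝ)) * hM.eigenvalues i + t * hN.eigenvalues i
    have hd1 : ∀ t i, hM.eigenvalues i < 0 → d t i < 0 := by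
      intro t i h
      have h' := (hneg i).1 h
      have := t.2.1
      have := t.2.2
      rcases eq_or_lt_of_le t.2.1 with h0 | h0
      · simp [d, ← h0, h]
      · simp only [d]; nlinarith
    have hd2 : ∀ t i, 0 < hM.eigenvalues i → 0 < d t i := by
      intro t i h
      have h' := (hpos i).1 h
      have := t.2.1
      have := t.2.2
      rcases eq_or_lt_of_le t.2.1 with h0 | h0
      · simp [d, ← h0, h]
      · simp only [d]; nlinarith
    have hd0 : ∀ t i, hM.eigenvalues i = 0 → d t i = 0 := by
      intro t i h
      have h1 := (hneg i).not.1 (by simp [h])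
      have h2 := (hpos i).not.1 (by simp [h])
      have h' : hN.eigenvalues i = 0 := le_antisymm (not_lt.1 h2) (not_lt.1 h1)
      simp [d, h, h']
    refine ⟨⟨⟨fun t => diagonal fun i => (d t i : ℂ), ?_⟩, ?_, ?_⟩, ?_⟩
    · refine Continuous.matrix_diagonal ?_
      simp only [d]
      fun_prop
    · simp [d]
    · simp [d]
    · intro t
      have := hermP_mem_conj hpr 1 (d t) (p := p) ?_ ?_
      · simpa using this
      · rw [← m1]; congr 1; ext i
        have a := hd1 t i; have b := hd2 t i; have c := hd0 t i
        simp only [Finset.mem_filter, Finset.mem_univ, true_and]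
        rcases lt_trichotomy (hM.eigenvalues i) 0 with h | h | h <;> grind
      · rw [← m2]; congr 1; ext i
        have a := hd1 t i; have b := hd2 t i; have c := hd0 t i
        simp only [Finset.mem_filter, Finset.mem_univ, true_and]
        rcases lt_trichotomy (hM.eigenvalues i) 0 with h | h | h <;> grind
end

section
/- Let r ≥ 1 and 0 < p < r be integers. Then the space Herm_p(ℂ^r) is simply connected. -/
open Matrix

open unitInterval in
theorem vk_aux {X ι : Type*} [TopologicalSpace X] {a b : X} (U : ι → Set X)
    (hopen : ∀ i, IsOpen (U i)) (hcov : ∀ x, ∃ i, x ∈ U i) (ha : ∀ i, a ∈ U i)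
    (hhom : ∀ i, ∀ (x y : X) (α β : Path x y), (∀ t, α t ∈ U i) → (∀ t, β t ∈ U i) →
      α.Homotopic β)
    (hconn : ∀ i j, IsPathConnected (U i ∩ U j)) (γ : Path a b) (i : ι) (hi : b ∈ U i) :
    ∃ α : Path a b, (∀ t, α t ∈ U i) ∧ γ.Homotopic α := by
  obtain ⟨t, ht0, hmono, ⟨N, hN⟩, hsub⟩ := exists_monotone_Icc_subset_open_cover_unitInterval
    (c := fun i => γ ⁻¹' (U i)) (fun i => (hopen i).preimage γ.continuous)
    (fun s _ => by simpa using hcov (γ s))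
  have key : ∀ n, ∀ i, γ (t n) ∈ U i → ∃ α : Path (γ 0) (γ (t n)), (∀ s, α s ∈ U i) ∧
      (γ.subpath 0 (t n)).Homotopic α := by
    intro n
    induction n with
    | zero =>
      intro i hi
      rw [ht0]
      refine ⟨Path.refl _, fun s => ?_, ?_⟩
      · simpa using ha i
      · rw [Path.subpath_self]
    | succ n ih =>
      intro i hi
      obtain ⟨j, hj⟩ := hsub n
      have hle := hmono (Nat.le_succ n)
      obtain ⟨α, hα, hαh⟩ := ih j (hj ⟨le_rfl, hle⟩)
      have h1 : (γ.subpath 0 (t (n+1))).Homotopic (α.trans (γ.subpath (t n) (t (n+1)))) :=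
        (Path.Homotopic.symm ⟨Path.Homotopy.subpathTransSubpath γ 0 (t n) (t (n+1))⟩).trans
          (hαh.hcomp (Path.Homotopic.refl _))
      have hin : ∀ s, (α.trans (γ.subpath (t n) (t (n+1)))) s ∈ U j := by
        intro s
        have hs : (α.trans (γ.subpath (t n) (t (n+1)))) s ∈
          Set.range (α.trans (γ.subpath (t n) (t (n+1)))) := ⟨s, rfl⟩
        rw [Path.trans_range] at hs
        rcases hs with ⟨u, hu⟩ | hs
        · rw [← hu]; exact hα u
        · rw [Path.range_subpath_of_le _ _ _ hle] at hs
          obtain ⟨u, hu, hus⟩ := hs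
          rw [← hus]; exact hj hu
      obtain ⟨β, hβ⟩ := (hconn i j).joinedIn (γ 0) (by simpa using ⟨ha i, ha j⟩)
        (γ (t (n+1))) ⟨hi, hj ⟨hle, le_rfl⟩⟩
      exact ⟨β, fun s => (hβ s).1, h1.trans (hhom j _ _ _ _ hin (fun s => (hβ s).2))⟩
  have h1 := key N i
  rw [hN N le_rfl] at h1
  obtain ⟨α, hα, hh⟩ := h1 (by simpa using hi)
  rw [Path.subpath_zero_one] at hh
  refine ⟨α.cast γ.source.symm γ.target.symm, fun t => by simpa using hα t, ?_⟩
  obtain ⟨H⟩ := hh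
  exact ⟨H.cast rfl rfl⟩

theorem vk_simplyConnected {X ι : Type*} [TopologicalSpace X] (a : X) (U : ι → Set X)
    (hopen : ∀ i, IsOpen (U i)) (hcov : ∀ x, ∃ i, x ∈ U i) (ha : ∀ i, a ∈ U i)
    (hhom : ∀ i, ∀ (x y : X) (α β : Path x y), (∀ t, α t ∈ U i) → (∀ t, β t ∈ U i) →
      α.Homotopic β)
    (hconn : ∀ i j, IsPathConnected (U i ∩ U j)) : SimplyConnectedSpace X := by
  have hj : ∀ x, Joined a x := by
    intro x
    obtain ⟨i, hi⟩ := hcov x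
    exact ((hconn i i).joinedIn a ⟨ha i, ha i⟩ x ⟨hi, hi⟩).joined
  rw [simply_connected_iff_paths_homotopic']
  refine ⟨⟨⟨a⟩, fun x y => (hj x).symm.trans (hj y)⟩, ?_⟩
  intro x y p q
  obtain ⟨i, hi⟩ := hcov y
  obtain ⟨δ⟩ := hj x
  obtain ⟨α, hα, h1⟩ := vk_aux U hopen hcov ha hhom hconn (δ.trans p) i hi
  obtain ⟨β, hβ, h2⟩ := vk_aux U hopen hcov ha hhom hconn (δ.trans q) i hi
  have h3 : (δ.trans p).Homotopic (δ.trans q) := h1.trans ((hhom i _ _ _ _ hα hβ).trans h2.symm)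
  have h4 : Path.Homotopic.Quotient.trans (.mk δ) (.mk p) =
      Path.Homotopic.Quotient.trans (.mk δ) (.mk q) := Quotient.sound h3
  have h5 := congrArg (Path.Homotopic.Quotient.trans (Path.Homotopic.Quotient.symm (.mk δ))) h4
  rw [← Path.Homotopic.Quotient.trans_assoc, ← Path.Homotopic.Quotient.trans_assoc] at h5
  simp only [Path.Homotopic.Quotient.symm_trans, Path.Homotopic.Quotient.refl_trans] at h5
  exact Quotient.exact h5

/-- Retract of a convex set gives homotopies. -/
theorem retract_hom {X E : Type*} [TopologicalSpace X] [AddCommGroup E] [Module ℝ E]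
    [TopologicalSpace E] [IsTopologicalAddGroup E] [ContinuousSMul ℝ E]
    (U : Set X) (C : Set E) (hC : Convex ℝ C) (s : X → E) (f : E → X)
    (hs : ContinuousOn s U) (hsC : ∀ x ∈ U, s x ∈ C) (hf : ContinuousOn f C)
    (hfs : ∀ x ∈ U, f (s x) = x) (x y : X) (α β : Path x y)
    (hα : ∀ t, α t ∈ U) (hβ : ∀ t, β t ∈ U) : α.Homotopic β := by
  have hx : x ∈ U := by simpa using hα 0
  have hy : y ∈ U := by simpa using hα 1
  have : ContractibleSpace C := hC.contractibleSpace ⟨_, hsC x hx⟩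
  let mk : (α : Path x y) → (∀ t, α t ∈ U) → Path (⟨s x, hsC x hx⟩ : C) ⟨s y, hsC y hy⟩ :=
    fun α hα => {
      toFun := fun t => ⟨s (α t), hsC _ (hα t)⟩
      continuous_toFun := by
        refine Continuous.subtype_mk ?_ _
        exact hs.comp_continuous α.continuous hα
      source' := by simp
      target' := by simp }
  obtain ⟨H⟩ := (SimplyConnectedSpace.paths_homotopic (mk α hα) (mk β hβ)).map
    (⟨C.domRestrict f, hf.domRestrict⟩ : C(C, X))
  have e : ∀ (α : Path x y) (hα : ∀ t, α t ∈ U), ∀ t, α t = f (s (α t)) :=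
    fun α hα t => (hfs _ (hα t)).symm
  refine ⟨{ toFun := H, map_zero_left := ?_, map_one_left := ?_, prop' := ?_ }⟩
  · intro t; rw [H.apply_zero]; exact hfs _ (hα t)
  · intro t; rw [H.apply_one]; exact hfs _ (hβ t)
  · intro t u hu
    have := H.prop' t u hu
    exact this.trans (hfs _ (hα u))

/-- Grassmannian modelled by orthogonal projections of trace `p`. -/
def GrP (r p : ℕ) : Set (Matrix (Fin r) (Fin r) ℂ) :=
  {P | P.IsHermitian ∧ P * P = P ∧ P.trace = (p : ℂ)}

/-- Orthogonal projection to the column space. -/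
noncomputable def colProj {r p : ℕ} (A : Matrix (Fin r) (Fin p) ℂ) : Matrix (Fin r) (Fin r) ℂ :=
  A * (Aᴴ * A)⁻¹ * Aᴴ

open scoped ComplexOrder in
theorem det_gram_ne {r p : ℕ} (A : Matrix (Fin r) (Fin p) ℂ) (L : Matrix (Fin p) (Fin r) ℂ)
    (h : (L * A).det ≠ 0) : (Aᴴ * A).det ≠ 0 := by
  have hinj : Function.Injective A.mulVec := by
    intro v w hvw
    have : (L * A).mulVec v = (L * A).mulVec w := by
      rw [← Matrix.mulVec_mulVec, ← Matrix.mulVec_mulVec, hvw]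
    exact Matrix.mulVec_injective_of_isUnit ((Matrix.isUnit_iff_isUnit_det _).2 h.isUnit) this
  have : (Aᴴ * A).PosDef := Matrix.PosDef.conjTranspose_mul_self A hinj
  exact (Matrix.isUnit_iff_isUnit_det _).1 this.isUnit |>.ne_zero

theorem colProj_mem {r p : ℕ} (A : Matrix (Fin r) (Fin p) ℂ) (h : (Aᴴ * A).det ≠ 0) :
    colProj A ∈ GrP r p := by
  have hu : IsUnit (Aᴴ * A).det := h.isUnit
  refine ⟨?_, ?_, ?_⟩
  · unfold colProj Matrix.IsHermitian
    simp [Matrix.conjTranspose_mul, Matrix.conjTranspose_nonsing_inv, Matrix.mul_assoc]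
  · unfold colProj
    have : A * (Aᴴ * A)⁻¹ * Aᴴ * (A * (Aᴴ * A)⁻¹ * Aᴴ) =
      A * ((Aᴴ * A)⁻¹ * (Aᴴ * A)) * (Aᴴ * A)⁻¹ * Aᴴ := by simp only [Matrix.mul_assoc]
    rw [this, Matrix.nonsing_inv_mul _ hu, Matrix.mul_one]
  · unfold colProj
    rw [Matrix.mul_assoc, Matrix.trace_mul_comm, Matrix.mul_assoc, Matrix.nonsing_inv_mul _ hu]
    simp

theorem colProj_continuousOn {r p : ℕ} (S : Set (Matrix (Fin r) (Fin p) ℂ))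
    (hS : ∀ A ∈ S, (Aᴴ * A).det ≠ 0) : ContinuousOn (colProj (r := r) (p := p)) S := by
  unfold colProj
  have h1 : ContinuousOn (fun A : Matrix (Fin r) (Fin p) ℂ => (Aᴴ * A)⁻¹) S := by
    simp only [Matrix.inv_def, Ring.inverse_eq_inv']
    refine ContinuousOn.smul (ContinuousOn.inv₀ ?_ hS) ?_
    · fun_prop
    · fun_prop
  rw [continuousOn_iff_continuous_domRestrict] at h1 ⊢
  have h2 : Continuous fun A : S => (A : Matrix (Fin r) (Fin p) ℂ) := continuous_subtype_val
  exact (h2.matrix_mul h1).matrix_mul h2.matrix_conjTranspose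

/-- section -/
noncomputable def grSec {r p : ℕ} (L : Matrix (Fin p) (Fin r) ℂ) (P : Matrix (Fin r) (Fin r) ℂ) :
    Matrix (Fin r) (Fin p) ℂ := P * Lᴴ * (L * P * Lᴴ)⁻¹

theorem grSec_continuousOn {r p : ℕ} (L : Matrix (Fin p) (Fin r) ℂ) :
    ContinuousOn (grSec L) {P | (L * P * Lᴴ).det ≠ 0} := by
  unfold grSec
  have h1 : ContinuousOn (fun P : Matrix (Fin r) (Fin r) ℂ => (L * P * Lᴴ)⁻¹)
      {P | (L * P * Lᴴ).det ≠ 0} := by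
    simp only [Matrix.inv_def, Ring.inverse_eq_inv']
    refine ContinuousOn.smul (ContinuousOn.inv₀ ?_ (fun _ h => h)) ?_
    · fun_prop
    · fun_prop
  rw [continuousOn_iff_continuous_domRestrict] at h1 ⊢
  have h2 : Continuous fun P : {P : Matrix (Fin r) (Fin r) ℂ | (L * P * Lᴴ).det ≠ 0} =>
    (P : Matrix (Fin r) (Fin r) ℂ) := continuous_subtype_val
  exact (h2.matrix_mul continuous_const).matrix_mul h1

theorem mul_grSec {r p : ℕ} (L : Matrix (Fin p) (Fin r) ℂ) (P : Matrix (Fin r) (Fin r) ℂ)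
    (h : (L * P * Lᴴ).det ≠ 0) : L * grSec L P = 1 := by
  unfold grSec
  rw [← Matrix.mul_assoc, ← Matrix.mul_assoc, Matrix.mul_nonsing_inv _ h.isUnit]

theorem det_colProj {r p : ℕ} (A : Matrix (Fin r) (Fin p) ℂ) (L : Matrix (Fin p) (Fin r) ℂ)
    (hA : (Aᴴ * A).det ≠ 0) :
    (L * colProj A * Lᴴ).det ≠ 0 ↔ (L * A).det ≠ 0 := by
  have : L * colProj A * Lᴴ = (L * A) * (Aᴴ * A)⁻¹ * (L * A)ᴴ := by
    unfold colProj; simp only [Matrix.conjTranspose_mul, Matrix.mul_assoc]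
  rw [this, Matrix.det_mul, Matrix.det_mul, Matrix.det_conjTranspose]
  have h2 : ((Aᴴ * A)⁻¹).det ≠ 0 := by
    rw [Matrix.det_nonsing_inv, Ring.inverse_eq_inv']; exact inv_ne_zero hA
  simp [hA]

open scoped ComplexOrder in
theorem colProj_grSec {r p : ℕ} (L : Matrix (Fin p) (Fin r) ℂ) (P : Matrix (Fin r) (Fin r) ℂ)
    (hP : P ∈ GrP r p) (h : (L * P * Lᴴ).det ≠ 0) : colProj (grSec L P) = P := by
  have hL : (L * grSec L P).det ≠ 0 := by rw [mul_grSec L P h]; simp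
  have hg := det_gram_ne _ _ hL
  obtain ⟨h1, h2, h3⟩ := colProj_mem _ hg
  obtain ⟨k1, k2, k3⟩ := hP
  set Q := colProj (grSec L P) with hQ
  have e1 : P * grSec L P = grSec L P := by
    unfold grSec; rw [← Matrix.mul_assoc, ← Matrix.mul_assoc, k2]
  have e2 : P * Q = Q := by
    rw [hQ]; unfold colProj; rw [← Matrix.mul_assoc, ← Matrix.mul_assoc, e1]
  have e3 : Q * P = Q := by
    have := congrArg Matrix.conjTranspose e2
    rwa [Matrix.conjTranspose_mul, h1.eq, k1.eq] at this
  have e4 : (P - Q)ᴴ * (P - Q) = P - Q := by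
    rw [Matrix.conjTranspose_sub, h1.eq, k1.eq, sub_mul, mul_sub, mul_sub, e2, e3, h2, k2]
    abel
  have e5 : ((P - Q)ᴴ * (P - Q)).trace = 0 := by
    rw [e4, Matrix.trace_sub, h3, k3, sub_self]
  rw [Matrix.trace_conjTranspose_mul_self_eq_zero_iff] at e5
  exact (sub_eq_zero.1 e5).symm

/-- complex line through two matrices: nonvanishing of polynomial off a finite set -/
theorem det_line_finite {n : ℕ} (F : ℂ → Matrix (Fin n) (Fin n) ℂ)
    (B C : Matrix (Fin n) (Fin n) ℂ) (hF : ∀ z, F z = B + z • C) (z₀ : ℂ)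
    (h : (F z₀).det ≠ 0) : {z | (F z).det = 0}.Finite := by
  let q : Polynomial ℂ :=
    (B.map Polynomial.C + (Polynomial.X : Polynomial ℂ) • C.map Polynomial.C).det
  have hq : ∀ z, q.eval z = (F z).det := by
    intro z
    rw [hF, ← Polynomial.coe_evalRingHom, RingHom.map_det]
    congr 1
    ext i j
    simp
    exact mul_comm _ _
  have hq0 : q ≠ 0 := by
    intro h0
    apply h
    rw [← hq, h0]; simp
  refine (q.roots.toFinset.finite_toSet).subset ?_
  intro z hz
  simp only [Finset.mem_coe, Multiset.mem_toFinset, Polynomial.mem_roots hq0, Polynomial.IsRoot]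
  rw [hq]; exact hz

theorem joined_dets {r p : ℕ} (L L' : Matrix (Fin p) (Fin r) ℂ) (A B : Matrix (Fin r) (Fin p) ℂ)
    (hA : (L * A).det ≠ 0) (hA' : (L' * A).det ≠ 0) (hB : (L * B).det ≠ 0)
    (hB' : (L' * B).det ≠ 0) :
    JoinedIn {A : Matrix (Fin r) (Fin p) ℂ | (L * A).det ≠ 0 ∧ (L' * A).det ≠ 0} A B := by
  have f1 := det_line_finite (fun z : ℂ => L * (A + z • (B - A))) (L * A) (L * (B - A))
    (fun z => by rw [Matrix.mul_add, Matrix.mul_smul]) 0 (by simpa using hA)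
  have f2 := det_line_finite (fun z : ℂ => L' * (A + z • (B - A))) (L' * A) (L' * (B - A))
    (fun z => by rw [Matrix.mul_add, Matrix.mul_smul]) 0 (by simpa using hA')
  have hpc := (f1.union f2).countable.isPathConnected_compl_of_one_lt_rank (E := ℂ)
    (by rw [Complex.rank_real_complex]; norm_num)
  have hj := hpc.joinedIn 0 (by simp [hA, hA']) 1 (by simp [hB, hB'])
  obtain ⟨γ, hγ⟩ := hj
  refine ⟨(γ.map (f := fun z : ℂ => A + z • (B - A)) (by fun_prop)).cast (by simp) (by simp), ?_⟩
  intro t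
  have := hγ t
  simp only [Set.mem_compl_iff, Set.mem_union, Set.mem_ofPred_eq, not_or] at this
  exact this

theorem exists_L {r p : ℕ} (P : Matrix (Fin r) (Fin r) ℂ) (hP : P ∈ GrP r p) :
    ∃ L : Matrix (Fin p) (Fin r) ℂ, (L * P * Lᴴ).det ≠ 0 := by
  obtain ⟨h1, h2, h3⟩ := hP
  have hev : ∀ i, h1.eigenvalues i = 0 ∨ h1.eigenvalues i = 1 := by
    have hd := h1.conjStarAlgAut_star_eigenvectorUnitary
    have hdd : (Matrix.diagonal (RCLike.ofReal ∘ h1.eigenvalues) : Matrix (Fin r) (Fin r) ℂ) *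
        Matrix.diagonal (RCLike.ofReal ∘ h1.eigenvalues) =
        Matrix.diagonal (RCLike.ofReal ∘ h1.eigenvalues) := by
      rw [← hd, ← map_mul, h2]
    intro i
    rw [Matrix.diagonal_mul_diagonal] at hdd
    have := congrFun (congrFun hdd i) i
    simp only [Matrix.diagonal_apply_eq, Function.comp_apply] at this
    have h' : h1.eigenvalues i * h1.eigenvalues i = h1.eigenvalues i := by
      simpa using congrArg Complex.re this
    have : h1.eigenvalues i * (h1.eigenvalues i - 1) = 0 := by linarith
    rcases mul_eq_zero.1 this with h | h
    · left; exact h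
    · right; linarith
  have hcard : (Finset.univ.filter fun i => h1.eigenvalues i = 1).card = p := by
    have ht := h1.trace_eq_sum_eigenvalues
    rw [h3] at ht
    have : ∑ i, h1.eigenvalues i = ((Finset.univ.filter fun i => h1.eigenvalues i = 1).card : ℝ) := by
      rw [Finset.card_filter]
      push_cast
      refine Finset.sum_congr rfl fun i _ => ?_
      rcases hev i with h | h <;> simp [h]
    have ht' : (p : ℝ) = ∑ i, h1.eigenvalues i := by
      have := congrArg Complex.re ht
      simpa using this
    rw [this] at ht'
    exact_mod_cast ht'.symm
  let e := (Finset.univ.filter fun i => h1.eigenvalues i = 1).equivFinOfCardEq hcard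
  let f : Fin p → Fin r := fun k => (e.symm k : Fin r)
  have hf : Function.Injective f := Subtype.val_injective.comp e.symm.injective
  have hf1 : ∀ k, h1.eigenvalues (f k) = 1 := fun k => (Finset.mem_filter.1 (e.symm k).2).2
  have hd := h1.conjStarAlgAut_star_eigenvectorUnitary
  rw [Unitary.conjStarAlgAut_star_apply] at hd
  refine ⟨(star (h1.eigenvectorUnitary : Matrix (Fin r) (Fin r) ℂ)).submatrix f id, ?_⟩
  have : (star (h1.eigenvectorUnitary : Matrix (Fin r) (Fin r) ℂ)).submatrix f id * P *
      ((star (h1.eigenvectorUnitary : Matrix (Fin r) (Fin r) ℂ)).submatrix f id)ᴴ =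
      (star (h1.eigenvectorUnitary : Matrix (Fin r) (Fin r) ℂ) * P *
        (h1.eigenvectorUnitary : Matrix (Fin r) (Fin r) ℂ)).submatrix f f := by
    ext i j
    simp [Matrix.mul_apply, Matrix.star_eq_conjTranspose, Matrix.conjTranspose_apply]
  rw [this, hd]
  have : (Matrix.diagonal (RCLike.ofReal ∘ h1.eigenvalues) : Matrix (Fin r) (Fin r) ℂ).submatrix f f
      = 1 := by
    rw [Matrix.submatrix_diagonal _ _ hf]
    rw [← Matrix.diagonal_one]
    congr 1
    ext k
    simp [hf1]
  rw [this]; simp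

theorem exists_common_L {r p : ℕ} (P Q : Matrix (Fin r) (Fin r) ℂ) (hP : P ∈ GrP r p)
    (hQ : Q ∈ GrP r p) :
    ∃ L : Matrix (Fin p) (Fin r) ℂ, (L * P * Lᴴ).det ≠ 0 ∧ (L * Q * Lᴴ).det ≠ 0 := by
  obtain ⟨L, hL⟩ := exists_L P hP
  obtain ⟨K, hK⟩ := exists_L Q hQ
  have eP := colProj_grSec L P hP hL
  have eQ := colProj_grSec K Q hQ hK
  have mP : (L * grSec L P).det ≠ 0 := by rw [mul_grSec L P hL]; simp
  have mQ : (K * grSec K Q).det ≠ 0 := by rw [mul_grSec K Q hK]; simp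
  have gP := det_gram_ne _ _ mP
  have gQ := det_gram_ne _ _ mQ
  have f1 := det_line_finite (fun z : ℂ => (L + z • (K - L)) * grSec L P)
    (L * grSec L P) ((K - L) * grSec L P)
    (fun z => by rw [Matrix.add_mul, Matrix.smul_mul]) 0 (by simpa using mP)
  have f2 := det_line_finite (fun z : ℂ => (L + z • (K - L)) * grSec K Q)
    (L * grSec K Q) ((K - L) * grSec K Q)
    (fun z => by rw [Matrix.add_mul, Matrix.smul_mul]) 1 (by simpa using mQ)
  obtain ⟨z, hz⟩ := (f1.union f2).infinite_compl.nonempty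
  simp only [Set.mem_compl_iff, Set.mem_union, Set.mem_ofPred_eq, not_or] at hz
  refine ⟨L + z • (K - L), ?_, ?_⟩
  · rw [← eP, det_colProj _ _ gP]; exact hz.1
  · rw [← eQ, det_colProj _ _ gQ]; exact hz.2

theorem GrP_nonempty {r p : ℕ} (h : p ≤ r) : (GrP r p).Nonempty := by
  refine ⟨Matrix.diagonal fun i : Fin r => if (i : ℕ) < p then 1 else 0, ?_, ?_, ?_⟩
  · rw [Matrix.isHermitian_diagonal_iff]
    intro i
    split_ifs <;> simp
  · rw [Matrix.diagonal_mul_diagonal]; simp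
  · rw [Matrix.trace_diagonal, Finset.sum_boole]
    congr 1
    have : (Finset.univ.filter fun i : Fin r => (i : ℕ) < p) =
      (Finset.univ : Finset (Fin p)).map (Fin.castLEEmb h) := by
      ext i
      simp only [Finset.mem_filter, Finset.mem_univ, true_and, Finset.mem_map, Fin.castLEEmb_apply]
      constructor
      · intro hi; exact ⟨⟨i, hi⟩, rfl⟩
      · rintro ⟨j, rfl⟩; exact j.2
    rw [this]; simp

theorem GrP_simplyConnected {r p : ℕ} (h : p ≤ r) : SimplyConnectedSpace (GrP r p) := by
  classical
  obtain ⟨P₀, hP₀⟩ := GrP_nonempty h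
  let f : Matrix (Fin r) (Fin p) ℂ → GrP r p := fun A =>
    if hA : (Aᴴ * A).det ≠ 0 then ⟨colProj A, colProj_mem A hA⟩ else ⟨P₀, hP₀⟩
  have hfv : ∀ A, (Aᴴ * A).det ≠ 0 → (f A : Matrix (Fin r) (Fin r) ℂ) = colProj A := by
    intro A hA; simp only [f, dif_pos hA]
  have hfc : ∀ S : Set (Matrix (Fin r) (Fin p) ℂ), (∀ A ∈ S, (Aᴴ * A).det ≠ 0) →
      ContinuousOn f S := by
    intro S hS
    rw [Topology.IsInducing.subtypeVal.continuousOn_iff]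
    exact (colProj_continuousOn S hS).congr fun A hA => hfv A (hS A hA)
  let ι := {L : Matrix (Fin p) (Fin r) ℂ // (L * P₀ * Lᴴ).det ≠ 0}
  let U : ι → Set (GrP r p) := fun L => {P | (L.1 * P.1 * L.1ᴴ).det ≠ 0}
  have hfsec : ∀ (L : ι), ∀ P ∈ U L, f (grSec L.1 P.1) = P := by
    intro L P hP
    apply Subtype.ext
    rw [hfv]
    · exact colProj_grSec _ _ P.2 hP
    · exact det_gram_ne _ L.1 (by rw [mul_grSec _ _ hP]; simp)
  refine vk_simplyConnected (⟨P₀, hP₀⟩ : GrP r p) U ?_ ?_ (fun L => L.2) ?_ ?_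
  · intro L
    refine isOpen_ne_fun (f := fun P : GrP r p => (L.1 * P.1 * L.1ᴴ).det) ?_ continuous_const
    exact ((continuous_const.matrix_mul continuous_subtype_val).matrix_mul
      continuous_const).matrix_det
  · intro P
    obtain ⟨L, h1, h2⟩ := exists_common_L P₀ P.1 hP₀ P.2
    exact ⟨⟨L, h1⟩, h2⟩
  · intro L x y α β hα hβ
    refine retract_hom (U L) {A : Matrix (Fin r) (Fin p) ℂ | L.1 * A = 1} ?_
      (fun P => grSec L.1 P.1) f ?_ ?_ ?_ (hfsec L) x y α β hα hβ
    · intro A hA B hB a b ha hb hab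
      simp only [Set.mem_ofPred_eq] at *
      rw [Matrix.mul_add, Matrix.mul_smul, Matrix.mul_smul, hA, hB, ← add_smul, hab, one_smul]
    · exact (grSec_continuousOn L.1).comp continuous_subtype_val.continuousOn fun P hP => hP
    · intro P hP; exact mul_grSec _ _ hP
    · refine hfc _ fun A hA => det_gram_ne _ L.1 ?_
      rw [Set.mem_ofPred_eq] at hA
      rw [hA]; simp
  · intro L K
    refine ⟨⟨P₀, hP₀⟩, ⟨L.2, K.2⟩, ?_⟩
    intro Q hQ
    have aux : ∀ P ∈ U L ∩ U K, (L.1 * grSec L.1 P.1).det ≠ 0 ∧ (K.1 * grSec L.1 P.1).det ≠ 0 := by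
      intro P hP
      have h1 : (L.1 * grSec L.1 P.1).det ≠ 0 := by rw [mul_grSec _ _ hP.1]; simp
      refine ⟨h1, ?_⟩
      rw [← det_colProj _ _ (det_gram_ne _ _ h1), colProj_grSec _ _ P.2 hP.1]
      exact hP.2
    have a1 := aux ⟨P₀, hP₀⟩ ⟨L.2, K.2⟩
    have a2 := aux Q hQ
    have hj := joined_dets L.1 K.1 _ _ a1.1 a1.2 a2.1 a2.2
    have hj2 := hj.map_continuousOn (f := f) (hfc _ fun A hA => det_gram_ne _ L.1 hA.1)
    rw [hfsec L _ hQ.1, hfsec L ⟨P₀, hP₀⟩ L.2] at hj2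
    refine hj2.mono ?_
    rintro _ ⟨A, hA, rfl⟩
    have hg := det_gram_ne _ L.1 hA.1
    constructor
    · change (L.1 * (f A).1 * L.1ᴴ).det ≠ 0
      rw [hfv A hg, det_colProj _ _ hg]; exact hA.1
    · change (K.1 * (f A).1 * K.1ᴴ).det ≠ 0
      rw [hfv A hg, det_colProj _ _ hg]; exact hA.2

theorem ev_ne_of_counts {r p : ℕ} (h : p ≤ r) (d : Fin r → ℝ)
    (h1 : (Finset.univ.filter fun i => d i < 0).card = p)
    (h2 : (Finset.univ.filter fun i => 0 < d i).card = r - p) (i : Fin r) : d i ≠ 0 := by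
  have hdisj : Disjoint (Finset.univ.filter fun i => d i < 0) (Finset.univ.filter fun i => 0 < d i) := by
    rw [Finset.disjoint_filter]
    intro i _ hi; linarith
  have hc := Finset.card_union_of_disjoint hdisj
  rw [h1, h2, Nat.add_sub_cancel' h] at hc
  have := (Finset.card_eq_iff_eq_univ _).1 (hc.trans (Fintype.card_fin r).symm)
  have hi := Finset.mem_univ i
  rw [← this, Finset.mem_union, Finset.mem_filter, Finset.mem_filter] at hi
  rcases hi with hi | hi
  · exact hi.2.ne
  · exact hi.2.ne'

theorem isUnit_of_ev {r : ℕ} {M : Matrix (Fin r) (Fin r) ℂ} (hM : M.IsHermitian)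
    (h : ∀ i, hM.eigenvalues i ≠ 0) : IsUnit M := by
  rw [Matrix.isUnit_iff_isUnit_det, isUnit_iff_ne_zero, hM.det_eq_prod_eigenvalues,
    Finset.prod_ne_zero_iff]
  intro i _
  exact Complex.ofReal_ne_zero.2 (h i)

theorem cfc_mem_HermP {r p : ℕ} (hpr : p ≤ r) {M : Matrix (Fin r) (Fin r) ℂ} (hM : M ∈ HermP r p)
    (g : ℝ → ℝ) (hg1 : ∀ x, x ≠ 0 → (g x < 0 ↔ x < 0)) (hg2 : ∀ x, x ≠ 0 → (0 < g x ↔ 0 < x)) :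
    cfc g M ∈ HermP r p := by
  obtain ⟨-, hH, c1, c2⟩ := hM
  have hne := ev_ne_of_counts hpr _ c1 c2
  have hH' : (cfc g M).IsHermitian := cfc_predicate g M
  have hroots : Multiset.map hH'.eigenvalues Finset.univ.val =
      Multiset.map (g ∘ hH.eigenvalues) Finset.univ.val := by
    have e1 := hH'.roots_charpoly_eq_eigenvalues
    rw [hH.charpoly_cfc_eq g, Polynomial.roots_prod _ _
      (by simp [Finset.prod_ne_zero_iff, Polynomial.X_sub_C_ne_zero])] at e1
    have e2 := congrArg (Multiset.map Complex.re) e1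
    simp only [Polynomial.roots_X_sub_C, Multiset.bind_singleton, Multiset.map_map] at e2
    simpa [Function.comp_def] using e2.symm
  have hcount : ∀ (q : ℝ → Prop) [DecidablePred q],
      (Finset.univ.filter fun i => q (hH'.eigenvalues i)).card =
      (Finset.univ.filter fun i => q (g (hH.eigenvalues i))).card := by
    intro q _
    have := congrArg (Multiset.countP q) hroots
    rw [Multiset.countP_map, Multiset.countP_map] at this
    exact this
  have d1 : (Finset.univ.filter fun i => hH'.eigenvalues i < 0).card = p := by
    rw [hcount (fun x => x < 0), ← c1]
    congr 1
    ext i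
    simp [hg1 _ (hne i)]
  have d2 : (Finset.univ.filter fun i => 0 < hH'.eigenvalues i).card = r - p := by
    rw [hcount (fun x => 0 < x), ← c2]
    congr 1
    ext i
    simp [hg2 _ (hne i)]
  exact ⟨isUnit_of_ev hH' (ev_ne_of_counts hpr _ d1 d2), hH', d1, d2⟩

/-- indicator of the negative reals -/
noncomputable def negInd (x : ℝ) : ℝ := if x < 0 then 1 else 0

theorem cont_fin {r : ℕ} (f : ℝ → ℝ) (M : Matrix (Fin r) (Fin r) ℂ) :
    ContinuousOn f (spectrum ℝ M) := M.finite_real_spectrum.continuousOn f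

theorem negProj_mem {r p : ℕ} {M : Matrix (Fin r) (Fin r) ℂ} (hM : M ∈ HermP r p) :
    cfc negInd M ∈ GrP r p := by
  obtain ⟨-, hH, c1, c2⟩ := hM
  refine ⟨cfc_predicate negInd M, ?_, ?_⟩
  · rw [← cfc_mul negInd negInd M (cont_fin _ _) (cont_fin _ _)]
    congr 1
    ext x
    unfold negInd
    split_ifs <;> simp
  · rw [hH.cfc_eq, Matrix.IsHermitian.cfc, Unitary.conjStarAlgAut_apply, Matrix.trace_mul_comm,
      ← mul_assoc]
    simp only [Unitary.coe_star_mul_self, one_mul, Matrix.trace_diagonal, Function.comp_apply]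
    rw [← c1, Finset.card_filter]
    push_cast
    refine Finset.sum_congr rfl fun i _ => ?_
    unfold negInd
    split_ifs <;> simp

theorem refl_mem {r p : ℕ} (hpr : p ≤ r) {P : Matrix (Fin r) (Fin r) ℂ} (hP : P ∈ GrP r p) :
    1 - (2 : ℝ) • P ∈ HermP r p := by
  obtain ⟨h1, h2, h3⟩ := hP
  have hH : (1 - (2 : ℝ) • P).IsHermitian := by
    unfold Matrix.IsHermitian
    rw [Matrix.conjTranspose_sub, Matrix.conjTranspose_smul, h1.eq]; simp
  have hsq : (1 - (2 : ℝ) • P) * (1 - (2 : ℝ) • P) = 1 := by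
    rw [sub_mul, mul_sub, mul_sub, smul_mul_smul_comm, h2]
    simp only [mul_one, one_mul]
    module
  have hev : ∀ i, hH.eigenvalues i = 1 ∨ hH.eigenvalues i = -1 := by
    have hd := hH.conjStarAlgAut_star_eigenvectorUnitary
    have hdd : (Matrix.diagonal (RCLike.ofReal ∘ hH.eigenvalues) : Matrix (Fin r) (Fin r) ℂ) *
        Matrix.diagonal (RCLike.ofReal ∘ hH.eigenvalues) = 1 := by
      rw [← hd, ← map_mul, hsq, map_one]
    intro i
    rw [Matrix.diagonal_mul_diagonal] at hdd
    have := congrFun (congrFun hdd i) i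
    simp only [Matrix.diagonal_apply_eq, Function.comp_apply, Matrix.one_apply_eq] at this
    have h' : hH.eigenvalues i * hH.eigenvalues i = 1 := by
      simpa using congrArg Complex.re this
    exact mul_self_eq_one_iff.1 h'
  have ht : ∑ i, hH.eigenvalues i = (r : ℝ) - 2 * p := by
    have := congrArg Complex.re hH.trace_eq_sum_eigenvalues
    rw [Matrix.trace_sub, Matrix.trace_smul, h3] at this
    simpa using this.symm
  have hs1 : ∑ i, hH.eigenvalues i =
      r - 2 * ((Finset.univ.filter fun i => hH.eigenvalues i < 0).card : ℝ) := by
    have : ∀ i, hH.eigenvalues i = 1 - 2 * (if hH.eigenvalues i < 0 then 1 else 0) := by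
      intro i
      rcases hev i with h | h <;> rw [h] <;> norm_num
    rw [Finset.sum_congr rfl fun i _ => this i, Finset.sum_sub_distrib, ← Finset.mul_sum,
      Finset.sum_boole]
    simp
  have hs2 : ∑ i, hH.eigenvalues i =
      2 * ((Finset.univ.filter fun i => 0 < hH.eigenvalues i).card : ℝ) - r := by
    have : ∀ i, hH.eigenvalues i = 2 * (if 0 < hH.eigenvalues i then 1 else 0) - 1 := by
      intro i
      rcases hev i with h | h <;> rw [h] <;> norm_num
    rw [Finset.sum_congr rfl fun i _ => this i, Finset.sum_sub_distrib, ← Finset.mul_sum,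
      Finset.sum_boole]
    simp
  have d1 : (Finset.univ.filter fun i => hH.eigenvalues i < 0).card = p := by
    have : ((Finset.univ.filter fun i => hH.eigenvalues i < 0).card : ℝ) = p := by linarith
    exact_mod_cast this
  have d2 : (Finset.univ.filter fun i => 0 < hH.eigenvalues i).card = r - p := by
    have : ((Finset.univ.filter fun i => 0 < hH.eigenvalues i).card : ℝ) = (r - p : ℕ) := by
      rw [Nat.cast_sub hpr]; linarith
    exact_mod_cast this
  exact ⟨isUnit_of_ev hH (ev_ne_of_counts hpr _ d1 d2), hH, d1, d2⟩

theorem negProj_refl {r : ℕ} {P : Matrix (Fin r) (Fin r) ℂ} (h1 : P.IsHermitian)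
    (h2 : P * P = P) : cfc negInd (1 - (2 : ℝ) • P) = P := by
  have hsa : IsSelfAdjoint P := h1
  have e : (1 - (2 : ℝ) • P) = cfc (fun x : ℝ => 1 - 2 * x) P := by
    rw [cfc_sub (fun _ => (1 : ℝ)) (fun x => 2 * x) P, cfc_const_one ℝ P,
      cfc_const_mul_id (2 : ℝ) P]
  have hspec : ∀ x ∈ spectrum ℝ P, x = 0 ∨ x = 1 := by
    intro x hx
    have e1 : cfc (fun x : ℝ => x * x) P = cfc (fun x : ℝ => x) P := by
      rw [cfc_mul (fun x : ℝ => x) (fun x => x) P, cfc_id' ℝ P, h2]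
    have := (cfc_eq_cfc_iff_eqOn (R := ℝ) (a := P) (hf := cont_fin _ _) (hg := cont_fin _ _)).1 e1 hx
    rcases mul_eq_zero.1 (show x * (x - 1) = 0 by linarith) with h | h
    · exact Or.inl h
    · exact Or.inr (by linarith)
  rw [e, ← cfc_comp' negInd (fun x : ℝ => 1 - 2 * x) P
    ((P.finite_real_spectrum.image _).continuousOn _) (cont_fin _ _)]
  conv_rhs => rw [← cfc_id' ℝ P]
  refine cfc_congr ?_
  intro x hx
  rcases hspec x hx with h | h <;> subst h <;> norm_num [negInd]

open scoped Matrix.Norms.L2Operator in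
theorem negProj_continuous {r p : ℕ} (hpr : p ≤ r) :
    Continuous fun M : HermP r p => cfc negInd (M : Matrix (Fin r) (Fin r) ℂ) := by
  refine Continuous.cfc_of_mem_nhdsSet (s := {0}ᶜ) negInd ?_ continuous_subtype_val
    (fun M => M.2.2.1) ?_
  · rw [isOpen_compl_singleton.mem_nhdsSet]
    intro x hx
    simp only [Set.mem_iUnion] at hx
    obtain ⟨M, hM⟩ := hx
    rintro h0
    rw [Set.mem_singleton_iff] at h0
    subst h0
    exact spectrum.zero_notMem ℝ M.2.1 hM
  · intro x hx
    apply ContinuousAt.continuousWithinAt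
    rcases lt_or_gt_of_ne hx with h | h
    · refine (continuousAt_const (y := (1 : ℝ))).congr ?_
      filter_upwards [gt_mem_nhds h] with y hy
      simp [negInd, hy]
    · refine (continuousAt_const (y := (0 : ℝ))).congr ?_
      filter_upwards [lt_mem_nhds h] with y hy
      simp [negInd, hy.not_gt]

theorem homotopy_mem {r p : ℕ} (hpr : p ≤ r) {M : Matrix (Fin r) (Fin r) ℂ} (hM : M ∈ HermP r p)
    (t : ℝ) (h0 : 0 ≤ t) (h1 : t ≤ 1) :
    (1 - t) • (1 - (2 : ℝ) • cfc negInd M) + t • M ∈ HermP r p := by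
  have hsa : IsSelfAdjoint M := hM.2.1
  have e : (1 - t) • (1 - (2 : ℝ) • cfc negInd M) + t • M =
      cfc (fun x => (1 - t) * (1 - 2 * negInd x) + t * x) M := by
    rw [cfc_add M (fun x => (1 - t) * (1 - 2 * negInd x)) (fun x => t * x) (cont_fin _ _) (cont_fin _ _),
      cfc_const_mul (1 - t) (fun x => 1 - 2 * negInd x) M (cont_fin _ _),
      cfc_sub (fun _ => (1 : ℝ)) (fun x => 2 * negInd x) M (cont_fin _ _) (cont_fin _ _),
      cfc_const_mul 2 negInd M (cont_fin _ _), cfc_const_mul_id t M, cfc_const_one ℝ M]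
  rw [e]
  have aux : ∀ x : ℝ, (x < 0 → (1 - t) * (1 - 2 * negInd x) + t * x < 0) ∧
      (0 < x → 0 < (1 - t) * (1 - 2 * negInd x) + t * x) := by
    intro x
    constructor
    · intro hx
      simp only [negInd, hx, if_true]
      rcases h0.eq_or_lt with h | h
      · subst h; norm_num
      · nlinarith
    · intro hx
      simp only [negInd, hx.not_gt, if_false]
      rcases h0.eq_or_lt with h | h
      · subst h; norm_num
      · nlinarith
  refine cfc_mem_HermP hpr hM _ ?_ ?_
  · intro x hx
    refine ⟨fun h => ?_, (aux x).1⟩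
    by_contra hn
    exact absurd h ((aux x).2 (lt_of_le_of_ne (not_lt.1 hn) hx.symm)).not_gt
  · intro x hx
    refine ⟨fun h => ?_, (aux x).2⟩
    by_contra hn
    exact absurd h ((aux x).1 (lt_of_le_of_ne (not_lt.1 hn) hx)).not_gt

/-- For `0 < p < r`, the space `Herm_p(ℂ^r)` is simply connected. -/
theorem hermP_simplyConnected (r p : ℕ) (hr : 1 ≤ r) (hp : 0 < p) (hpr : p < r) :
    SimplyConnectedSpace (HermP r p) := by
  have := GrP_simplyConnected hpr.le
  let ρ : C(HermP r p, GrP r p) :=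
    ⟨fun M => ⟨cfc negInd M.1, negProj_mem M.2⟩, (negProj_continuous hpr.le).subtype_mk _⟩
  let ι : C(GrP r p, HermP r p) :=
    ⟨fun P => ⟨1 - (2 : ℝ) • P.1, refl_mem hpr.le P.2⟩, by
      refine Continuous.subtype_mk ?_ _
      exact continuous_const.sub (continuous_subtype_val.const_smul (2 : ℝ))⟩
  have e : ContinuousMap.HomotopyEquiv (HermP r p) (GrP r p) :=
    { toFun := ρ
      invFun := ι
      left_inv := by
        refine ⟨{ toFun := fun x => ⟨(1 - (x.1 : ℝ)) • (1 - (2 : ℝ) • cfc negInd x.2.1) +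
                    (x.1 : ℝ) • x.2.1, homotopy_mem hpr.le x.2.2 _ x.1.2.1 x.1.2.2⟩
                  continuous_toFun := ?_
                  map_zero_left := ?_
                  map_one_left := ?_ }⟩
        · refine Continuous.subtype_mk ?_ _
          have c1 : Continuous fun x : unitInterval × HermP r p => (x.1 : ℝ) :=
            continuous_subtype_val.comp continuous_fst
          have c2 : Continuous fun x : unitInterval × HermP r p => x.2.1 :=
            continuous_subtype_val.comp continuous_snd
          have c3 : Continuous fun x : unitInterval × HermP r p => cfc negInd x.2.1 :=
            (negProj_continuous hpr.le).comp continuous_snd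
          exact ((continuous_const.sub c1).smul (continuous_const.sub (c3.const_smul (2 : ℝ)))).add
            (c1.smul c2)
        · intro M
          apply Subtype.ext
          simp [ρ, ι]
        · intro M
          apply Subtype.ext
          simp
      right_inv := by
        have : ρ.comp ι = ContinuousMap.id _ := by
          ext1 P
          apply Subtype.ext
          exact negProj_refl P.2.1 P.2.2.1
        rw [this] }
  exact e.simplyConnectedSpace
end

section
/- For every t ∈ (0,1), the real number c_f(t) is nonzero. -/
open Set

/-- Under the assumptions that `b ∘ f = 0` on `(0,1)`, that the gradient of `b` along `f`
is nonzero and that `f' ≠ 0` on `(0,1)`, the quantity `c_f(t)` is nonzero for all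
`t ∈ (0,1)`. -/
theorem cf_ne_zero (a b : ℝ × ℝ → ℝ) (ha : ContDiff ℝ 1 a) (hb : ContDiff ℝ 1 b)
    (f : ℝ → ℝ × ℝ) (f' : ℝ → ℝ × ℝ)
    (hf : ∀ t ∈ Ioo (0 : ℝ) 1, HasDerivAt f (f' t) t)
    (hbf : ∀ t ∈ Ioo (0 : ℝ) 1, b (f t) = 0)
    (hgrad : ∀ t ∈ Ioo (0 : ℝ) 1,
      ((fderiv ℝ b (f t)) (1, 0), (fderiv ℝ b (f t)) (0, 1)) ≠ (0 : ℝ × ℝ))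
    (hf' : ∀ t ∈ Ioo (0 : ℝ) 1, f' t ≠ (0 : ℝ × ℝ)) :
    ∀ t ∈ Ioo (0 : ℝ) 1,
      (-(fderiv ℝ b (f t)) (1, 0) * (f' t).2 + (fderiv ℝ b (f t)) (0, 1) * (f' t).1) /
        (((fderiv ℝ b (f t)) (1, 0)) ^ 2 + ((fderiv ℝ b (f t)) (0, 1)) ^ 2) ≠ 0 := by
  intro t ht
  have hbd : HasFDerivAt b (fderiv ℝ b (f t)) (f t) :=
    ((hb.differentiable (by norm_num)) (f t)).hasFDerivAt
  have h1 : HasDerivAt (b ∘ f) (fderiv ℝ b (f t) (f' t)) t := hbd.comp_hasDerivAt t (hf t ht)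
  have h2 : HasDerivAt (b ∘ f) 0 t := by
    refine (hasDerivAt_const t (0 : ℝ)).congr_of_eventuallyEq ?_
    filter_upwards [isOpen_Ioo.mem_nhds ht] with s hs
    exact hbf s hs
  have h3 : fderiv ℝ b (f t) (f' t) = 0 := h1.unique h2
  have h4 : f' t = (f' t).1 • ((1, 0) : ℝ × ℝ) + (f' t).2 • ((0, 1) : ℝ × ℝ) := by
    ext <;> simp
  rw [h4, map_add, map_smul, map_smul, smul_eq_mul, smul_eq_mul] at h3
  have hg := hgrad t ht
  have hv := hf' t ht
  generalize fderiv ℝ b (f t) (1, 0) = p at *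
  generalize fderiv ℝ b (f t) (0, 1) = q at *
  have hpq : p ^ 2 + q ^ 2 ≠ 0 := by
    intro h
    apply hg
    have hp : p = 0 := by nlinarith [sq_nonneg p, sq_nonneg q]
    have hq : q = 0 := by nlinarith [sq_nonneg p, sq_nonneg q]
    simp [hp, hq]
  refine div_ne_zero (fun h => hv ?_) hpq
  have hx : (f' t).1 = 0 :=
    (mul_eq_zero.mp (by linear_combination p * h3 + q * h :
      (p ^ 2 + q ^ 2) * (f' t).1 = 0)).resolve_left hpq
  have hy : (f' t).2 = 0 :=
    (mul_eq_zero.mp (by linear_combination q * h3 - p * h :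
      (p ^ 2 + q ^ 2) * (f' t).2 = 0)).resolve_left hpq
  exact Prod.ext hx hy
end

section
/- Let a(x,y) = 2 + cos x + cos y and b(x,y) = sin y − cos x. Then the set {(x,y) ∈ [0,2π) × [0,2π) | |a(x,y)| ≤ 1 and b(x,y) = 0} equals the union of the images of the two paths f₁, f₂ : [0,1] → ℝ² given by f₁(t) = ((t+1)π/2, (t+2)π/2) and f₂(t) = ((t+2)π/2, (−t+3)π/2). -/
open Real Set

/-- For `a(x,y) = 2 + cos x + cos y` and `b(x,y) = sin y − cos x`, the Fermi arc in the
fundamental domain `[0,2π) × [0,2π)` is the union of the images of the paths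
`f₁(t) = ((t+1)π/2, (t+2)π/2)` and `f₂(t) = ((t+2)π/2, (−t+3)π/2)`, `t ∈ [0,1]`. -/
theorem third_example :
    {p : ℝ × ℝ | p.1 ∈ Ico 0 (2 * π) ∧ p.2 ∈ Ico 0 (2 * π) ∧
      |2 + Real.cos p.1 + Real.cos p.2| ≤ 1 ∧ Real.sin p.2 - Real.cos p.1 = 0}
    = ((fun t : ℝ => ((t + 1) * π / 2, (t + 2) * π / 2)) '' Icc 0 1)
      ∪ ((fun t : ℝ => ((t + 2) * π / 2, (-t + 3) * π / 2)) '' Icc 0 1) := by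
  have hpi := Real.pi_pos
  have key : ∀ u : ℝ, 0 ≤ u → u ≤ π / 2 →
      |2 + -Real.sin u + -Real.cos u| ≤ 1 := by
    intro u h0 h1
    have hs := Real.sin_nonneg_of_nonneg_of_le_pi h0 (by linarith)
    have hc := Real.cos_nonneg_of_neg_pi_div_two_le_of_le (by linarith) h1
    have h := Real.sin_sq_add_cos_sq u
    have hs1 := Real.sin_le_one u
    have hc1 := Real.cos_le_one u
    rw [abs_le]
    constructor
    · linarith
    · nlinarith
  ext ⟨x, y⟩
  simp only [mem_ofPred_eq, mem_union, mem_image, mem_Icc, mem_Ico, Prod.mk.injEq]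
  constructor
  · rintro ⟨⟨hx0, hx1⟩, ⟨hy0, hy1⟩, ha, hb⟩
    have hsc : Real.sin y + Real.cos y ≤ -1 := by
      have := (abs_le.mp ha).2
      linarith
    have h := Real.sin_sq_add_cos_sq y
    have hs : Real.sin y ≤ 0 := by
      have := Real.neg_one_le_cos y
      linarith
    have hc : Real.cos y ≤ 0 := by
      have := Real.neg_one_le_sin y
      linarith
    have hy2 : π ≤ y := by
      by_contra! hlt
      rcases hy0.eq_or_lt with h0 | h0
      · rw [← h0, Real.cos_zero] at hc
        linarith
      · have := Real.sin_pos_of_pos_of_lt_pi h0 hlt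
        linarith
    have hy3 : y ≤ 3 * π / 2 := by
      by_contra! hlt
      have := Real.cos_pos_of_mem_Ioo (x := 2 * π - y) ⟨by linarith, by linarith⟩
      rw [Real.cos_two_pi_sub] at this
      linarith
    have hz : Real.cos (y - π / 2) = Real.cos x := by
      rw [Real.cos_sub_pi_div_two]
      linarith
    rcases le_total x π with hxp | hxp
    · have e := Real.injOn_cos (x₁ := y - π / 2) (x₂ := x)
        ⟨by linarith, by linarith⟩ ⟨hx0, hxp⟩ hz
      have e2 : y / π * π = y := by field_simp
      refine Or.inl ⟨2 * (y / π) - 2, ⟨?_, ?_⟩, ?_, ?_⟩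
      · have : 1 ≤ y / π := by rw [le_div_iff₀ hpi]; linarith
        linarith
      · have : y / π ≤ 3 / 2 := by rw [div_le_iff₀ hpi]; linarith
        linarith
      · linarith
      · linarith
    · have e := Real.injOn_cos (x₁ := y - π / 2) (x₂ := 2 * π - x)
        ⟨by linarith, by linarith⟩ ⟨by linarith, by linarith⟩
        (by rw [Real.cos_two_pi_sub]; exact hz)
      have e2 : y / π * π = y := by field_simp
      refine Or.inr ⟨3 - 2 * (y / π), ⟨?_, ?_⟩, ?_, ?_⟩
      · have : y / π ≤ 3 / 2 := by rw [div_le_iff₀ hpi]; linarith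
        linarith
      · have : 1 ≤ y / π := by rw [le_div_iff₀ hpi]; linarith
        linarith
      · linarith
      · linarith
  · rintro (⟨t, ⟨h0, h1⟩, rfl, rfl⟩ | ⟨t, ⟨h0, h1⟩, rfl, rfl⟩)
    · have p0 : 0 ≤ t * π := by positivity
      have p1 : t * π ≤ π := by nlinarith
      have ec : Real.cos ((t + 1) * π / 2) = -Real.sin (t * π / 2) := by
        rw [← Real.cos_add_pi_div_two]; congr 1; ring
      have ec2 : Real.cos ((t + 2) * π / 2) = -Real.cos (t * π / 2) := by
        rw [← Real.cos_add_pi]; congr 1; ring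
      have es : Real.sin ((t + 2) * π / 2) = -Real.sin (t * π / 2) := by
        rw [← Real.sin_add_pi]; congr 1; ring
      refine ⟨⟨by linarith, by linarith⟩, ⟨by linarith, by linarith⟩, ?_, ?_⟩
      · rw [ec, ec2]
        exact key _ (by linarith) (by linarith)
      · rw [ec, es]; ring
    · have p0 : 0 ≤ t * π := by positivity
      have p1 : t * π ≤ π := by nlinarith
      have ec : Real.cos ((t + 2) * π / 2) = -Real.cos (t * π / 2) := by
        rw [← Real.cos_add_pi]; congr 1; ring
      have ey : (-t + 3) * π / 2 = (π / 2 - t * π / 2) + π := by ring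
      have ec2 : Real.cos ((-t + 3) * π / 2) = -Real.sin (t * π / 2) := by
        rw [ey, Real.cos_add_pi, Real.cos_pi_div_two_sub]
      have es : Real.sin ((-t + 3) * π / 2) = -Real.cos (t * π / 2) := by
        rw [ey, Real.sin_add_pi, Real.sin_pi_div_two_sub]
      refine ⟨⟨by linarith, by linarith⟩, ⟨by linarith, by linarith⟩, ?_, ?_⟩
      · rw [ec, ec2]
        have := key (t * π / 2) (by linarith) (by linarith)
        rwa [add_right_comm] at this
      · rw [ec, es]; ring
end
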